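/- Let $G = \mathrm{GL}_3(\mathbb{F}_p)$ and $B$ the upper-triangular Borel subgroup, and let $\chi = \eta^a \otimes \eta^b \otimes \eta^c$ be a character of $B$ over $\overline{\mathbb{F}}_p$ with $a, b, c$ pairwise distinct mod $p-1$. Then $\mathrm{Ind}_B^G \chi$ is multiplicity free, i.e., all of its Jordan–Hölder factors as a $\overline{\mathbb{F}}_p[G]$-module are pairwise non-isomorphic. -/

import Mathlib

open Matrix

variable (p : ℕ) [Fact p.Prime]

/-- `G = GL₃(𝔽_p)`. -/
abbrev Gp := GL (Fin 3) (ZMod p)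

/-- `k = 𝔽̄_p`, an algebraic closure of `𝔽_p`. -/
abbrev kbar := AlgebraicClosure (ZMod p)

/-- The right regular action of `g ∈ G` on the space of `k`-valued functions on `G`. -/
def rT (g : Gp p) : (Gp p → kbar p) →ₗ[kbar p] (Gp p → kbar p) where
  toFun f := fun x => f (x * g)
  map_add' := by intros; rfl
  map_smul' := by intros; rfl

/-- A subspace stable under the right regular `G`-action. -/
def GStable (S : Submodule (kbar p) (Gp p → kbar p)) : Prop :=
  ∀ g : Gp p, ∀ f ∈ S, rT p g f ∈ S

/-- The action of `g` on the subquotient `Y/(X ∩ Y)` of two `G`-stable subspaces. -/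
noncomputable def subquotAct (X Y : Submodule (kbar p) (Gp p → kbar p))
    (hX : GStable p X) (hY : GStable p Y) (g : Gp p) :
    (Y ⧸ X.comap Y.subtype) →ₗ[kbar p] (Y ⧸ X.comap Y.subtype) :=
  Submodule.mapQ _ _ ((rT p g).restrict fun f hf => hY g f hf) (fun f hf => hX g f hf)

/-- The subquotients `Y₁/(X₁ ∩ Y₁)` and `Y₂/(X₂ ∩ Y₂)` are isomorphic as `k[G]`-modules. -/
def GFactorIso (X₁ Y₁ X₂ Y₂ : Submodule (kbar p) (Gp p → kbar p)) : Prop :=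
  ∃ (hX₁ : GStable p X₁) (hY₁ : GStable p Y₁) (hX₂ : GStable p X₂) (hY₂ : GStable p Y₂)
    (e : (Y₁ ⧸ X₁.comap Y₁.subtype) ≃ₗ[kbar p] (Y₂ ⧸ X₂.comap Y₂.subtype)),
    ∀ (g : Gp p) (q : Y₁ ⧸ X₁.comap Y₁.subtype),
      e (subquotAct p X₁ Y₁ hX₁ hY₁ g q) = subquotAct p X₂ Y₂ hX₂ hY₂ g (e q)

/-- The subquotient `Y/X` is a simple `k[G]`-module. -/
def GSimpleFactor (X Y : Submodule (kbar p) (Gp p → kbar p)) : Prop :=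
  GStable p X ∧ GStable p Y ∧ X < Y ∧
    ∀ Z : Submodule (kbar p) (Gp p → kbar p), GStable p Z → X ≤ Z → Z ≤ Y → Z = X ∨ Z = Y

/-- `Ind_B^G χ` for `χ = η^a ⊗ η^b ⊗ η^c` over `𝔽̄_p`: the functions `f : G → k` with
`f(Bg) = χ(B) f(g)` for all upper-triangular `B`. -/
def IndSet (a b c : ℕ) : Set (Gp p → kbar p) :=
  {f | ∀ B g : Gp p,
    (B : Matrix (Fin 3) (Fin 3) (ZMod p)) 1 0 = 0 →
    (B : Matrix (Fin 3) (Fin 3) (ZMod p)) 2 0 = 0 →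
    (B : Matrix (Fin 3) (Fin 3) (ZMod p)) 2 1 = 0 →
    f (B * g) =
      (algebraMap (ZMod p) (kbar p) ((B : Matrix (Fin 3) (Fin 3) (ZMod p)) 0 0)) ^ a *
      (algebraMap (ZMod p) (kbar p) ((B : Matrix (Fin 3) (Fin 3) (ZMod p)) 1 1)) ^ b *
      (algebraMap (ZMod p) (kbar p) ((B : Matrix (Fin 3) (Fin 3) (ZMod p)) 2 2)) ^ c *
      f g}


section GenA
variable {k E ι : Type*} [Field k] [AddCommGroup E] [Module k E] (ρ : ι → E →ₗ[k] E)

def ZStab (S : Submodule k E) : Prop := ∀ g, ∀ f ∈ S, ρ g f ∈ S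

def ZSimp (F : Submodule k E) : Prop :=
  ZStab ρ F ∧ F ≠ ⊥ ∧ ∀ Z : Submodule k E, ZStab ρ Z → Z ≤ F → Z = ⊥ ∨ Z = F

def ZEqv (Y : Submodule k E) (φ : E →ₗ[k] E) : Prop :=
  ∀ g, ∀ y ∈ Y, φ (ρ g y) = ρ g (φ y)

def ZOcc (F V : Submodule k E) : Prop :=
  ∃ Y : Submodule k E, Y ≤ V ∧ ZStab ρ Y ∧ ∃ φ : E →ₗ[k] E, ZEqv ρ Y φ ∧ Y.map φ = F

def ZIso (F F' : Submodule k E) : Prop :=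
  ∃ C : E →ₗ[k] E, ZEqv ρ F C ∧ F.map C = F' ∧ ∀ x ∈ F, C x = 0 → x = 0

def ZFac (X Y F : Submodule k E) : Prop :=
  ∃ ψ : E →ₗ[k] E, ZEqv ρ Y ψ ∧ Y.map ψ = F ∧ ∀ x ∈ Y, ψ x = 0 ↔ x ∈ X

lemma z_factor {D E' E'' : Type*} [AddCommGroup D] [Module k D] [AddCommGroup E'] [Module k E']
    [AddCommGroup E''] [Module k E'']
    (A : D →ₗ[k] E') (B : D →ₗ[k] E'') (h : ∀ x, A x = 0 → B x = 0) :
    ∃ C : E' →ₗ[k] E'', ∀ x, C (A x) = B x := by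
  have hr : LinearMap.range A.rangeRestrict = ⊤ := LinearMap.range_rangeRestrict A
  obtain ⟨s, hs⟩ := A.rangeRestrict.exists_rightInverse_of_surjective hr
  obtain ⟨C, hC⟩ := LinearMap.exists_extend (B ∘ₗ s)
  refine ⟨C, fun x => ?_⟩
  have h1 : C (A x) = B (s (A.rangeRestrict x)) := by
    have := LinearMap.congr_fun hC (A.rangeRestrict x)
    simpa using this
  rw [h1]
  have h2 : A.rangeRestrict (s (A.rangeRestrict x)) = A.rangeRestrict x :=
    LinearMap.congr_fun hs (A.rangeRestrict x)
  have h3 : A (s (A.rangeRestrict x) - x) = 0 := by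
    have this : A (s (A.rangeRestrict x)) = A x := congrArg Subtype.val h2
    rw [map_sub, this, sub_self]
  have := h _ h3
  rwa [map_sub, sub_eq_zero] at this

lemma z_map_stab {Y : Submodule k E} {φ : E →ₗ[k] E} (hY : ZStab ρ Y) (hφ : ZEqv ρ Y φ) :
    ZStab ρ (Y.map φ) := by
  rintro g _ ⟨y, hy, rfl⟩
  exact ⟨ρ g y, hY g y hy, hφ g y hy⟩

lemma z_inf_stab {Y X : Submodule k E} (hY : ZStab ρ Y) (hX : ZStab ρ X) : ZStab ρ (Y ⊓ X) :=
  fun g f hf => ⟨hY g f hf.1, hX g f hf.2⟩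

lemma z_ker_stab {Y : Submodule k E} {φ : E →ₗ[k] E} (hY : ZStab ρ Y) (hφ : ZEqv ρ Y φ) :
    ZStab ρ (Y ⊓ LinearMap.ker φ) := by
  rintro g f ⟨hf, hk⟩
  refine ⟨hY g f hf, ?_⟩
  have hk' : φ f = 0 := hk
  show φ _ = 0
  rw [hφ g f hf, hk', map_zero]

lemma z_occ_transfer {F V V' : Submodule k E} (hF : ZSimp ρ F) (T T' : E →ₗ[k] E)
    (hT : ∀ g x, T (ρ g x) = ρ g (T x)) (hT' : ∀ g x, T' (ρ g x) = ρ g (T' x))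
    (hV : ZStab ρ V)
    (hm' : ∀ x ∈ V', T' x ∈ V)
    (hex : ∀ x ∈ V', T' x = 0 → ∃ y ∈ V, T y = x) (h : ZOcc ρ F V') : ZOcc ρ F V := by
  obtain ⟨Y, hYV, hY, φ, hφ, rfl⟩ := h
  have hK : ZStab ρ (Y ⊓ LinearMap.ker T') := z_ker_stab ρ hY (fun g y _ => hT' g y)
  have hφK : ZEqv ρ (Y ⊓ LinearMap.ker T') φ := fun g y hy => hφ g y hy.1
  rcases hF.2.2 ((Y ⊓ LinearMap.ker T').map φ) (z_map_stab ρ hK hφK)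
    (Submodule.map_mono inf_le_left) with h0 | h1
  · have hz : ∀ y : Y, (T' ∘ₗ Y.subtype) y = 0 → (φ ∘ₗ Y.subtype) y = 0 := by
      intro y hy
      have : φ y ∈ (Y ⊓ LinearMap.ker T').map φ := ⟨y, ⟨y.2, hy⟩, rfl⟩
      rw [h0] at this
      exact this
    obtain ⟨C, hC⟩ := z_factor _ _ hz
    have hC' : ∀ y ∈ Y, C (T' y) = φ y := fun y hy => hC ⟨y, hy⟩
    refine ⟨Y.map T', ?_, z_map_stab ρ hY (fun g y _ => hT' g y), C, ?_, ?_⟩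
    · rintro _ ⟨y, hy, rfl⟩; exact hm' y (hYV hy)
    · rintro g _ ⟨y, hy, rfl⟩
      rw [← hT', hC' _ (hY g y hy), hC' y hy, hφ g y hy]
    · ext z
      constructor
      · rintro ⟨_, ⟨y, hy, rfl⟩, rfl⟩; exact ⟨y, hy, (hC' y hy).symm⟩
      · rintro ⟨y, hy, rfl⟩; exact ⟨_, ⟨y, hy, rfl⟩, hC' y hy⟩
  · refine ⟨V ⊓ (Y ⊓ LinearMap.ker T').comap T, inf_le_left, ?_, φ ∘ₗ T, ?_, ?_⟩
    · rintro g f ⟨hf, hf2⟩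
      refine ⟨hV g f hf, ?_⟩
      show T (ρ g f) ∈ (Y ⊓ LinearMap.ker T')
      rw [hT]; exact hK g _ hf2
    · rintro g y ⟨_, hy⟩
      show φ (T _) = ρ g (φ (T y))
      rw [hT, hφK g _ hy]
    · rw [← h1]
      ext z
      constructor
      · rintro ⟨y, ⟨_, hy⟩, rfl⟩; exact ⟨T y, hy, rfl⟩
      · rintro ⟨y, hy, rfl⟩
        obtain ⟨x, hx, rfl⟩ := hex y (hYV hy.1) hy.2
        exact ⟨x, ⟨hx, hy⟩, rfl⟩

lemma z_occ_fac {F : Submodule k E} (hF : ZSimp ρ F) {n : ℕ} (ch : Fin (n + 1) → Submodule k E)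
    (h0 : ch 0 = ⊥) (hst : ∀ i, ZStab ρ (ch i)) (hlt : ∀ i : Fin n, ch i.castSucc < ch i.succ)
    (hs : ∀ i : Fin n, ∀ Z : Submodule k E, ZStab ρ Z → ch i.castSucc ≤ Z → Z ≤ ch i.succ →
      Z = ch i.castSucc ∨ Z = ch i.succ)
    (h : ZOcc ρ F (ch (Fin.last n))) : ∃ i : Fin n, ZFac ρ (ch i.castSucc) (ch i.succ) F := by
  obtain ⟨Y, hYV, hY, φ, hφ, rfl⟩ := h
  have key : ∃ i : Fin n, (Y ⊓ ch i.castSucc).map φ = ⊥ ∧ (Y ⊓ ch i.succ).map φ ≠ ⊥ := by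
    by_contra hcon
    push Not at hcon
    have : ∀ i : Fin (n + 1), (Y ⊓ ch i).map φ = ⊥ := by
      intro i
      induction i using Fin.induction with
      | zero => rw [h0]; simp
      | succ i ih => exact hcon i ih
    have h1 := this (Fin.last n)
    rw [inf_eq_left.mpr hYV] at h1
    exact hF.2.1 h1
  obtain ⟨i, hi0, hi1⟩ := key
  have hZst : ZStab ρ (Y ⊓ ch i.succ) := z_inf_stab ρ hY (hst _)
  have hZe : ZEqv ρ (Y ⊓ ch i.succ) φ := fun g y hy => hφ g y hy.1
  have hZF : (Y ⊓ ch i.succ).map φ = Y.map φ := by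
    rcases hF.2.2 _ (z_map_stab ρ hZst hZe) (Submodule.map_mono inf_le_left) with h | h
    · exact absurd h hi1
    · exact h
  have hkill : ∀ y ∈ Y, y ∈ ch i.castSucc → φ y = 0 := by
    intro y hy hyc
    have : φ y ∈ (Y ⊓ ch i.castSucc).map φ := ⟨y, ⟨hy, hyc⟩, rfl⟩
    rw [hi0] at this; exact this
  have hst' : ZStab ρ (ch i.castSucc ⊔ (Y ⊓ ch i.succ)) := by
    intro g f hf
    obtain ⟨a, ha, b, hb, rfl⟩ := Submodule.mem_sup.mp hf
    rw [map_add]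
    exact Submodule.add_mem_sup (hst _ g a ha) (hZst g b hb)
  have hsup : ch i.castSucc ⊔ (Y ⊓ ch i.succ) = ch i.succ := by
    rcases hs i (ch i.castSucc ⊔ (Y ⊓ ch i.succ)) hst' le_sup_left
      (sup_le (hlt i).le inf_le_right) with h | h
    · exfalso
      apply hi1
      rw [eq_bot_iff]
      rintro _ ⟨y, hy, rfl⟩
      refine hkill y hy.1 ?_
      rw [← h]; exact Submodule.mem_sup_right hy
    · exact h
  let A : (ch i.castSucc × (Y ⊓ ch i.succ : Submodule k E)) →ₗ[k] E :=
    LinearMap.coprod (Submodule.subtype _) (Submodule.subtype _)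
  let B : (ch i.castSucc × (Y ⊓ ch i.succ : Submodule k E)) →ₗ[k] E :=
    LinearMap.coprod 0 (φ ∘ₗ Submodule.subtype _)
  have hAB : ∀ x, A x = 0 → B x = 0 := by
    rintro ⟨⟨a, ha⟩, ⟨b, hb⟩⟩ h
    have h' : a + b = 0 := by simpa [A] using h
    have : b ∈ ch i.castSucc := by
      have : b = -a := by rw [eq_neg_iff_add_eq_zero, add_comm]; exact h'
      rw [this]; exact neg_mem ha
    simpa [B] using hkill b hb.1 this
  obtain ⟨ψ, hψ⟩ := z_factor A B hAB
  have hψ' : ∀ a ∈ ch i.castSucc, ∀ b ∈ Y ⊓ ch i.succ, ψ (a + b) = φ b := by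
    intro a ha b hb
    have := hψ (⟨a, ha⟩, ⟨b, hb⟩)
    simpa [A, B] using this
  have hψe : ZEqv ρ (ch i.succ) ψ := by
    intro g y hy
    rw [← hsup] at hy
    obtain ⟨a, ha, b, hb, rfl⟩ := Submodule.mem_sup.mp hy
    rw [map_add, hψ' _ (hst _ g a ha) _ (hZst g b hb), hψ' a ha b hb, hZe g b hb]
  have hψm : (ch i.succ).map ψ = Y.map φ := by
    rw [← hZF]
    ext z
    constructor
    · rintro ⟨y, hy, rfl⟩
      rw [← hsup] at hy
      obtain ⟨a, ha, b, hb, rfl⟩ := Submodule.mem_sup.mp hy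
      exact ⟨b, hb, (hψ' a ha b hb).symm⟩
    · rintro ⟨b, hb, rfl⟩
      refine ⟨b, hb.2, ?_⟩
      have := hψ' 0 (zero_mem _) b hb
      rwa [zero_add] at this
  have hc0 : ∀ a ∈ ch i.castSucc, ψ a = 0 := by
    intro a ha
    have := hψ' a ha 0 (zero_mem _)
    simpa using this
  refine ⟨i, ψ, hψe, hψm, fun x hx => ⟨fun h => ?_, hc0 x⟩⟩
  rcases hs i (ch i.succ ⊓ LinearMap.ker ψ) (z_ker_stab ρ (hst _) hψe)
    (fun a ha => ⟨(hlt i).le ha, hc0 a ha⟩) inf_le_left with h1 | h1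
  · rw [← h1]; exact ⟨hx, h⟩
  · exfalso
    apply hF.2.1
    rw [← hψm, eq_bot_iff]
    rintro _ ⟨y, hy, rfl⟩
    rw [← h1] at hy
    exact hy.2

lemma z_fac_iso {X Y F F' : Submodule k E} (hY : ZStab ρ Y) (h : ZFac ρ X Y F)
    (h' : ZFac ρ X Y F') : ZIso ρ F F' := by
  obtain ⟨ψ, he, rfl, hk⟩ := h
  obtain ⟨ψ', he', rfl, hk'⟩ := h'
  obtain ⟨C, hC⟩ := z_factor (ψ ∘ₗ Y.subtype) (ψ' ∘ₗ Y.subtype)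
    (fun y hy => (hk' y y.2).mpr ((hk y y.2).mp hy))
  have hC' : ∀ y ∈ Y, C (ψ y) = ψ' y := fun y hy => hC ⟨y, hy⟩
  refine ⟨C, ?_, ?_, ?_⟩
  · rintro g _ ⟨y, hy, rfl⟩
    rw [← he g y hy, hC' _ (hY g y hy), hC' y hy, he' g y hy]
  · ext z
    constructor
    · rintro ⟨_, ⟨y, hy, rfl⟩, rfl⟩; exact ⟨y, hy, (hC' y hy).symm⟩
    · rintro ⟨y, hy, rfl⟩; exact ⟨_, ⟨y, hy, rfl⟩, hC' y hy⟩
  · rintro _ ⟨y, hy, rfl⟩ h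
    rw [hC' y hy] at h
    exact (hk y hy).mpr ((hk' y hy).mp h)

lemma z_fac_finrank [FiniteDimensional k E] {X Y F : Submodule k E} (hXY : X ≤ Y)
    (h : ZFac ρ X Y F) : Module.finrank k Y = Module.finrank k X + Module.finrank k F := by
  obtain ⟨ψ, he, rfl, hk⟩ := h
  have h1 := LinearMap.finrank_range_add_finrank_ker (ψ ∘ₗ Y.subtype)
  have h2 : LinearMap.range (ψ ∘ₗ Y.subtype) = Y.map ψ := by
    rw [LinearMap.range_comp, Submodule.range_subtype]
  have h3 : LinearMap.ker (ψ ∘ₗ Y.subtype) = X.comap Y.subtype := by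
    ext y
    exact hk y y.2
  rw [h2, h3] at h1
  have h4 : Module.finrank k (X.comap Y.subtype) = Module.finrank k X :=
    (Submodule.comapSubtypeEquivOfLe hXY).finrank_eq
  omega

lemma z_core [FiniteDimensional k E] {κ : Type*} [Fintype κ] (F : κ → Submodule k E)
    (hF : ∀ l, ZSimp ρ (F l)) (hni : ∀ l l', l ≠ l' → ¬ ZIso ρ (F l) (F l'))
    {n : ℕ} (ch : Fin (n + 1) → Submodule k E)
    (h0 : ch 0 = ⊥) (hst : ∀ i, ZStab ρ (ch i)) (hlt : ∀ i : Fin n, ch i.castSucc < ch i.succ)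
    (hs : ∀ i : Fin n, ∀ Z : Submodule k E, ZStab ρ Z → ch i.castSucc ≤ Z → Z ≤ ch i.succ →
      Z = ch i.castSucc ∨ Z = ch i.succ)
    (hocc : ∀ l, ZOcc ρ (F l) (ch (Fin.last n)))
    (hdim : Module.finrank k (ch (Fin.last n)) ≤ ∑ l, Module.finrank k (F l)) :
    ∃ L : Fin n → κ, Function.Injective L ∧
      ∀ i, ZFac ρ (ch i.castSucc) (ch i.succ) (F (L i)) := by
  choose I hI using fun l => z_occ_fac ρ (hF l) ch h0 hst hlt hs (hocc l)
  have hinj : Function.Injective I := by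
    intro l l' h
    by_contra hne
    have h1 := hI l
    rw [h] at h1
    exact hni l l' hne (z_fac_iso ρ (hst _) h1 (hI l'))
  let d : Fin n → ℕ := fun i => Module.finrank k (ch i.succ) - Module.finrank k (ch i.castSucc)
  have hd : ∀ i, Module.finrank k (ch i.succ) = Module.finrank k (ch i.castSucc) + d i := by
    intro i
    have := Submodule.finrank_mono (hlt i).le
    simp only [d]; omega
  have hdpos : ∀ i, 0 < d i := by
    intro i
    have := Submodule.finrank_lt_finrank_of_lt (hlt i)
    simp only [d]; omega
  have hsum : Module.finrank k (ch (Fin.last n)) = ∑ i, d i := by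
    have : ∀ m : ℕ, ∀ c : Fin (m + 1) → Submodule k E, ∀ e : Fin m → ℕ, c 0 = ⊥ →
        (∀ i, Module.finrank k (c i.succ) = Module.finrank k (c i.castSucc) + e i) →
        Module.finrank k (c (Fin.last m)) = ∑ i, e i := by
      intro m
      induction m with
      | zero => intro c e hc _; simp [Fin.last, hc]
      | succ m ih =>
        intro c e hc he
        rw [Fin.sum_univ_castSucc, ← ih (fun i => c i.castSucc) (fun i => e i.castSucc) hc
          (fun i => he i.castSucc)]
        exact he (Fin.last m)
    exact this n ch d h0 hd
  have hFd : ∀ l, Module.finrank k (F l) = d (I l) := by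
    intro l
    have h1 := z_fac_finrank ρ (hlt (I l)).le (hI l)
    have h2 := hd (I l)
    omega
  have hsurj : Function.Surjective I := by
    classical
    intro i
    by_contra hcon
    push Not at hcon
    have h1 : ∑ l, Module.finrank k (F l) = ∑ j ∈ Finset.univ.image I, d j := by
      rw [Finset.sum_image (fun a _ b _ h => hinj h)]
      exact Finset.sum_congr rfl fun l _ => hFd l
    have h2 : ∑ j ∈ Finset.univ.image I, d j < ∑ j, d j := by
      apply Finset.sum_lt_sum_of_subset (Finset.subset_univ _) (Finset.mem_univ i)
      · simp [hcon]
      · exact hdpos i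
      · intros; exact Nat.zero_le _
    omega
  choose L hL using hsurj
  refine ⟨L, fun i j h => by rw [← hL i, ← hL j, h], fun i => ?_⟩
  have := hI (L i)
  rwa [hL i] at this
end GenA

def zT {R : Type*} [CommRing R] (n : ZMod p → Gp p) (φ : Gp p → R) : Gp p → R :=
  fun g => ∑ t, φ (n t * g)

def indR {R : Type*} [CommRing R] (τ : ZMod p →* R) (a b c : ℕ) (φ : Gp p → R) : Prop :=
  ∀ B g : Gp p, (B : Matrix (Fin 3) (Fin 3) (ZMod p)) 1 0 = 0 →
    (B : Matrix (Fin 3) (Fin 3) (ZMod p)) 2 0 = 0 →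
    (B : Matrix (Fin 3) (Fin 3) (ZMod p)) 2 1 = 0 →
    φ (B * g) = τ ((B : Matrix (Fin 3) (Fin 3) (ZMod p)) 0 0) ^ a *
      τ ((B : Matrix (Fin 3) (Fin 3) (ZMod p)) 1 1) ^ b *
      τ ((B : Matrix (Fin 3) (Fin 3) (ZMod p)) 2 2) ^ c * φ g

def zn1 (t : ZMod p) : Gp p :=
  GeneralLinearGroup.mkOfDetNeZero !![0,1,0;1,t,0;0,0,1] (by simp [det_fin_three])
def zn2 (t : ZMod p) : Gp p :=
  GeneralLinearGroup.mkOfDetNeZero !![1,0,0;0,0,1;0,1,t] (by simp [det_fin_three])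

lemma zmk_coe (A : Matrix (Fin 3) (Fin 3) (ZMod p)) (h : det A ≠ 0) :
    ((GeneralLinearGroup.mkOfDetNeZero A h : Gp p) : Matrix (Fin 3) (Fin 3) (ZMod p)) = A := rfl
lemma zn1_coe (t : ZMod p) : ((zn1 p t : Gp p) : Matrix (Fin 3) (Fin 3) (ZMod p)) =
   !![0,1,0;1,t,0;0,0,1] := rfl
lemma zn2_coe (t : ZMod p) : ((zn2 p t : Gp p) : Matrix (Fin 3) (Fin 3) (ZMod p)) =
   !![1,0,0;0,0,1;0,1,t] := rfl

lemma zdiag (B : Gp p) (h1 : (B : Matrix (Fin 3) (Fin 3) (ZMod p)) 1 0 = 0)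
    (h2 : (B : Matrix (Fin 3) (Fin 3) (ZMod p)) 2 0 = 0)
    (h3 : (B : Matrix (Fin 3) (Fin 3) (ZMod p)) 2 1 = 0) :
    (B : Matrix (Fin 3) (Fin 3) (ZMod p)) 0 0 ≠ 0 ∧
    (B : Matrix (Fin 3) (Fin 3) (ZMod p)) 1 1 ≠ 0 ∧
    (B : Matrix (Fin 3) (Fin 3) (ZMod p)) 2 2 ≠ 0 := by
  have : det (B : Matrix (Fin 3) (Fin 3) (ZMod p)) ≠ 0 := by
    exact GeneralLinearGroup.det_ne_zero B
  rw [det_fin_three, h1, h2, h3] at this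
  refine ⟨?_, ?_, ?_⟩ <;> intro h <;> apply this <;> rw [h] <;> ring

lemma zbij (x y z : ZMod p) (hx : x ≠ 0) (hy : y ≠ 0) :
    Function.Bijective (fun t : ZMod p => (z + t * y) / x) := by
  apply Function.Injective.bijective_of_finite
  intro t t' h
  simp only at h
  field_simp at h
  have : t * y = t' * y := by linear_combination h
  exact mul_right_cancel₀ hy this

lemma zT1_ind {R : Type*} [CommRing R] (τ : ZMod p →* R) (a b c : ℕ) (φ : Gp p → R)
    (h : indR p τ a b c φ) : indR p τ b a c (zT p (zn1 p) φ) := by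
  intro B g h1 h2 h3
  obtain ⟨hx, hy, hl⟩ := zdiag p B h1 h2 h3
  set M := (B : Matrix (Fin 3) (Fin 3) (ZMod p)) with hM
  have key : ∀ t, φ (zn1 p t * (B * g)) = τ (M 1 1) ^ a * τ (M 0 0) ^ b * τ (M 2 2) ^ c *
      φ (zn1 p ((M 0 1 + t * M 1 1) / M 0 0) * g) := by
    intro t
    have hd : det !![M 1 1, 0, M 1 2; 0, M 0 0, M 0 2 + t * M 1 2; 0, 0, M 2 2] ≠ 0 := by
      simp [det_fin_three, hx, hy, hl]
    have he : zn1 p t * (B * g) = GeneralLinearGroup.mkOfDetNeZero _ hd *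
        (zn1 p ((M 0 1 + t * M 1 1) / M 0 0) * g) := by
      rw [← mul_assoc, ← mul_assoc]
      congr 1
      ext i j
      simp only [Units.val_mul, zmk_coe, zn1_coe, ← hM]
      fin_cases i <;> fin_cases j <;> simp [Matrix.mul_apply, Fin.sum_univ_three, h1, h2, h3] <;> field_simp
    rw [he, h _ _ (by simp [zmk_coe]) (by simp [zmk_coe]) (by simp [zmk_coe])]
    simp [zmk_coe]
  show ∑ t, φ (zn1 p t * (B * g)) = _ * ∑ t, φ (zn1 p t * g)
  rw [Finset.sum_congr rfl (fun t _ => key t), ← Finset.mul_sum,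
    (zbij p _ _ (M 0 1) hx hy).sum_comp (fun t => φ (zn1 p t * g))]
  ring

lemma zT2_ind {R : Type*} [CommRing R] (τ : ZMod p →* R) (a b c : ℕ) (φ : Gp p → R)
    (h : indR p τ a b c φ) : indR p τ a c b (zT p (zn2 p) φ) := by
  intro B g h1 h2 h3
  obtain ⟨hl, hx, hy⟩ := zdiag p B h1 h2 h3
  set M := (B : Matrix (Fin 3) (Fin 3) (ZMod p)) with hM
  have key : ∀ t, φ (zn2 p t * (B * g)) = τ (M 0 0) ^ a * τ (M 2 2) ^ b * τ (M 1 1) ^ c *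
      φ (zn2 p ((M 1 2 + t * M 2 2) / M 1 1) * g) := by
    intro t
    have hd : det !![M 0 0, M 0 2 - M 0 1 * ((M 1 2 + t * M 2 2) / M 1 1), M 0 1;
        0, M 2 2, 0; 0, 0, M 1 1] ≠ 0 := by
      simp [det_fin_three, hx, hy, hl]
    have he : zn2 p t * (B * g) = GeneralLinearGroup.mkOfDetNeZero _ hd *
        (zn2 p ((M 1 2 + t * M 2 2) / M 1 1) * g) := by
      rw [← mul_assoc, ← mul_assoc]
      congr 1
      ext i j
      simp only [Units.val_mul, zmk_coe, zn2_coe, ← hM]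
      fin_cases i <;> fin_cases j <;> simp [Matrix.mul_apply, Fin.sum_univ_three, h1, h2, h3] <;> field_simp
    rw [he, h _ _ (by simp [zmk_coe]) (by simp [zmk_coe]) (by simp [zmk_coe])]
    simp [zmk_coe]
  show ∑ t, φ (zn2 p t * (B * g)) = _ * ∑ t, φ (zn2 p t * g)
  rw [Finset.sum_congr rfl (fun t _ => key t), ← Finset.mul_sum,
    (zbij p _ _ (M 1 2) hx hy).sum_comp (fun t => φ (zn2 p t * g))]
  ring

lemma zgen : ∃ ζ : ZMod p, ζ ≠ 0 ∧ ∀ a b : ℕ, ζ ^ a = ζ ^ b ↔ a ≡ b [MOD p - 1] := by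
  obtain ⟨g, hg⟩ := IsCyclic.exists_generator (α := (ZMod p)ˣ)
  refine ⟨g, g.ne_zero, fun a b => ?_⟩
  have ho : orderOf g = p - 1 := by
    rw [orderOf_eq_card_of_forall_mem_zpowers hg, Nat.card_eq_fintype_card, ZMod.card_units]
  rw [← Units.val_pow_eq_pow_val, ← Units.val_pow_eq_pow_val, Units.val_inj, pow_eq_pow_iff_modEq, ho]

lemma zcharsum {R : Type*} [CommRing R] [IsDomain R] (τ : ZMod p →* R)
    (hτ : Function.Injective τ) (a b : ℕ) (hab : ¬ a ≡ b [MOD p - 1]) :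
    ∑ t ∈ Finset.univ.erase (0 : ZMod p), τ (-1 / t) ^ a * τ t ^ b = 0 := by
  obtain ⟨ζ, h0, hζ⟩ := zgen p
  set S := ∑ t ∈ Finset.univ.erase (0 : ZMod p), τ (-1 / t) ^ a * τ t ^ b with hS
  have h1 : τ ζ ^ a * S = τ ζ ^ b * S := by
    have : S = ∑ t ∈ Finset.univ.erase (0 : ZMod p), τ (-1 / (ζ * t)) ^ a * τ (ζ * t) ^ b := by
      rw [hS]
      symm
      apply Finset.sum_bij (fun t _ => ζ * t)
      · intro t ht; simpa [h0] using ht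
      · intro t _ t' _ h; exact mul_left_cancel₀ h0 h
      · intro t ht
        refine ⟨ζ⁻¹ * t, by simpa [h0] using ht, ?_⟩
        field_simp
      · intros; rfl
    conv_lhs => rw [this]
    rw [hS, Finset.mul_sum, Finset.mul_sum]
    refine Finset.sum_congr rfl fun t ht => ?_
    have ht0 : t ≠ 0 := by simpa using ht
    rw [← mul_assoc, ← mul_pow, ← map_mul, map_mul τ ζ t, mul_pow]
    have : ζ * (-1 / (ζ * t)) = -1 / t := by field_simp
    rw [this]; ring
  by_contra hne
  have h2 := mul_right_cancel₀ hne h1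
  rw [← map_pow, ← map_pow] at h2
  exact hab ((hζ a b).mp (hτ h2))

lemma zTT {R : Type*} [CommRing R] [IsDomain R] (τ : ZMod p →* R)
    (hτ : Function.Injective τ) (n : ZMod p → Gp p) (φ : Gp p → R)
    (a b : ℕ) (hab : ¬ a ≡ b [MOD p - 1])
    (h0 : ∀ t' g, φ (n 0 * (n t' * g)) = φ g)
    (h1 : ∀ t t' g, t ≠ 0 → φ (n t * (n t' * g)) =
      τ (-1 / t) ^ a * τ t ^ b * φ (n (t' + 1 / t) * g)) :
    zT p n (zT p n φ) = fun g => (p : R) * φ g := by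
  funext g
  show ∑ t', ∑ t, φ (n t * (n t' * g)) = _
  rw [Finset.sum_comm, ← Finset.add_sum_erase _ _ (Finset.mem_univ (0 : ZMod p))]
  have e1 : ∑ t', φ (n 0 * (n t' * g)) = p * φ g := by
    simp [h0, ZMod.card]
  have e2 : ∀ t ∈ Finset.univ.erase (0 : ZMod p), ∑ t', φ (n t * (n t' * g)) =
      τ (-1 / t) ^ a * τ t ^ b * zT p n φ g := by
    intro t ht
    have ht0 : t ≠ 0 := by simpa using ht
    rw [Finset.sum_congr rfl (fun t' _ => h1 t t' g ht0), ← Finset.mul_sum]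
    congr 1
    exact Equiv.sum_comp (Equiv.addRight (1 / t)) (fun s => φ (n s * g))
  rw [e1, Finset.sum_congr rfl e2, ← Finset.sum_mul, zcharsum p τ hτ a b hab]
  ring

lemma zTT1 {R : Type*} [CommRing R] [IsDomain R] (τ : ZMod p →* R)
    (hτ : Function.Injective τ) (φ : Gp p → R) (a b c : ℕ) (hab : ¬ a ≡ b [MOD p - 1])
    (h : indR p τ a b c φ) :
    zT p (zn1 p) (zT p (zn1 p) φ) = fun g => (p : R) * φ g := by
  apply zTT p τ hτ _ _ a b hab
  · intro t' g
    rw [← mul_assoc, h]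
    all_goals simp [zn1_coe]
  · intro t t' g ht
    have hd : det !![-1 / t, 1, 0; 0, t, 0; 0, 0, 1] ≠ 0 := by
      simp [det_fin_three, ht]
    have he : zn1 p t * (zn1 p t' * g) = GeneralLinearGroup.mkOfDetNeZero _ hd *
        (zn1 p (t' + 1 / t) * g) := by
      rw [← mul_assoc, ← mul_assoc]
      congr 1
      ext i j
      simp only [Units.val_mul, zmk_coe, zn1_coe]
      fin_cases i <;> fin_cases j <;> simp [Matrix.mul_apply, Fin.sum_univ_three] <;> field_simp <;> ring
    rw [he, h _ _ (by simp [zmk_coe]) (by simp [zmk_coe]) (by simp [zmk_coe])]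
    simp [zmk_coe]

lemma zTT2 {R : Type*} [CommRing R] [IsDomain R] (τ : ZMod p →* R)
    (hτ : Function.Injective τ) (φ : Gp p → R) (a b c : ℕ) (hab : ¬ b ≡ c [MOD p - 1])
    (h : indR p τ a b c φ) :
    zT p (zn2 p) (zT p (zn2 p) φ) = fun g => (p : R) * φ g := by
  apply zTT p τ hτ _ _ b c hab
  · intro t' g
    rw [← mul_assoc, h]
    all_goals simp [zn2_coe]
  · intro t t' g ht
    have hd : det !![1, 0, 0; 0, -1 / t, 1; 0, 0, t] ≠ 0 := by
      simp [det_fin_three, ht]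
    have he : zn2 p t * (zn2 p t' * g) = GeneralLinearGroup.mkOfDetNeZero _ hd *
        (zn2 p (t' + 1 / t) * g) := by
      rw [← mul_assoc, ← mul_assoc]
      congr 1
      ext i j
      simp only [Units.val_mul, zmk_coe, zn2_coe]
      fin_cases i <;> fin_cases j <;> simp [Matrix.mul_apply, Fin.sum_univ_three] <;> field_simp <;> ring
    rw [he, h _ _ (by simp [zmk_coe]) (by simp [zmk_coe]) (by simp [zmk_coe])]
    simp [zmk_coe]

noncomputable def IndS (a b c : ℕ) : Submodule (kbar p) (Gp p → kbar p) where
  carrier := IndSet p a b c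
  zero_mem' := by intro B g _ _ _; simp
  add_mem' := by
    intro f f' hf hf' B g h1 h2 h3
    show f (B * g) + f' (B * g) = _ * (f g + f' g)
    rw [hf B g h1 h2 h3, hf' B g h1 h2 h3]; ring
  smul_mem' := by
    intro r f hf B g h1 h2 h3
    show r * f (B * g) = _ * (r * f g)
    rw [hf B g h1 h2 h3]; ring

lemma mem_IndS (a b c : ℕ) (f : Gp p → kbar p) :
    f ∈ IndS p a b c ↔ indR p ((algebraMap (ZMod p) (kbar p) : ZMod p →* kbar p)) a b c f := Iff.rfl

lemma IndS_stab (a b c : ℕ) : ZStab (rT p) (IndS p a b c) := by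
  intro g f hf B x h1 h2 h3
  show f (B * x * g) = _ * f (x * g)
  rw [mul_assoc, hf B _ h1 h2 h3]

noncomputable def zTL (n : ZMod p → Gp p) : (Gp p → kbar p) →ₗ[kbar p] (Gp p → kbar p) where
  toFun := zT p n
  map_add' f g := by funext x; simp [zT, Finset.sum_add_distrib]
  map_smul' r g := by funext x; simp [zT, Finset.mul_sum]

lemma zTL_comm (n : ZMod p → Gp p) (g : Gp p) (x : Gp p → kbar p) :
    zTL p n (rT p g x) = rT p g (zTL p n x) := by
  funext y
  show ∑ t, x (n t * y * g) = ∑ t, x (n t * (y * g))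
  simp [mul_assoc]

lemma kbar_charP : CharP (kbar p) p := inferInstance

lemma witt_div (x : WittVector p (kbar p)) (h : WittVector.constantCoeff x = 0) :
    ∃ y : WittVector p (kbar p), (p : WittVector p (kbar p)) * y = x := by
  have h0 : x.coeff 0 = 0 := h
  have h1 := WittVector.verschiebung_shift x 0 (by
    intro i hi
    interval_cases i
    exact h0)
  obtain ⟨z, hz⟩ := (WittVector.frobenius_bijective p (kbar p)).2 (x.shift 1)
  refine ⟨z, ?_⟩
  rw [mul_comm, ← WittVector.verschiebung_frobenius, hz]
  rw [h1]; ext i; simp [WittVector.shift_coeff]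

lemma zexact (n : ZMod p → Gp p) (a b c a' b' c' : ℕ) 
    (hT : ∀ φ : Gp p → WittVector p (kbar p),
      indR p ((WittVector.teichmuller p).comp (algebraMap (ZMod p) (kbar p) : ZMod p →* kbar p))
        a' b' c' φ → 
      indR p ((WittVector.teichmuller p).comp (algebraMap (ZMod p) (kbar p) : ZMod p →* kbar p))
        a b c (zT p n φ))
    (hTT : ∀ φ : Gp p → WittVector p (kbar p),
      indR p ((WittVector.teichmuller p).comp (algebraMap (ZMod p) (kbar p) : ZMod p →* kbar p))
        a' b' c' φ → zT p n (zT p n φ) = fun g => (p : WittVector p (kbar p)) * φ g)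
    (x : Gp p → kbar p) (hx : x ∈ IndS p a' b' c') (h0 : zTL p n x = 0) :
    ∃ y ∈ IndS p a b c, zTL p n y = x := by
  set φ : Gp p → WittVector p (kbar p) := fun g => WittVector.teichmuller p (x g) with hφ
  have hc : ∀ r : kbar p, WittVector.constantCoeff (WittVector.teichmuller p r) = r := fun r =>
    WittVector.teichmuller_coeff_zero p r
  have hind : indR p ((WittVector.teichmuller p).comp
      (algebraMap (ZMod p) (kbar p) : ZMod p →* kbar p)) a' b' c' φ := by
    intro B g h1 h2 h3
    simp only [hφ]
    rw [hx B g h1 h2 h3]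
    simp only [map_mul, map_pow]
    rfl
  have hp0 : (p : WittVector p (kbar p)) ≠ 0 := WittVector.p_nonzero p (kbar p)
  have hdiv : ∀ g, ∃ y : WittVector p (kbar p), (p : WittVector p (kbar p)) * y = zT p n φ g := by
    intro g
    apply witt_div
    have := congrFun h0 g
    simp only [zT, map_sum, hφ, hc]
    exact this
  choose ψ hψ using hdiv
  have hψi : indR p ((WittVector.teichmuller p).comp
      (algebraMap (ZMod p) (kbar p) : ZMod p →* kbar p)) a b c ψ := by
    intro B g h1 h2 h3
    apply mul_left_cancel₀ hp0
    rw [hψ, hT φ hind B g h1 h2 h3, ← hψ]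
    ring
  have hTψ : ∀ g, zT p n ψ g = φ g := by
    intro g
    apply mul_left_cancel₀ hp0
    have := congrFun (hTT φ hind) g
    rw [← this]
    simp only [zT, Finset.mul_sum, hψ]
  refine ⟨fun g => WittVector.constantCoeff (ψ g), ?_, ?_⟩
  · intro B g h1 h2 h3
    show WittVector.constantCoeff (ψ (B * g)) = _ * WittVector.constantCoeff (ψ g)
    rw [hψi B g h1 h2 h3]
    simp only [map_mul, map_pow, MonoidHom.comp_apply, hc]
    rfl
  · funext g
    show ∑ t, WittVector.constantCoeff (ψ (n t * g)) = x g
    rw [← map_sum]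
    have := congrArg WittVector.constantCoeff (hTψ g)
    rw [hφ] at this
    simp only [hc] at this
    exact this

lemma zteich_inj : Function.Injective ((WittVector.teichmuller p).comp
      (algebraMap (ZMod p) (kbar p) : ZMod p →* kbar p)) := by
  intro x y h
  have := congrArg (fun z => WittVector.coeff z 0) h
  simp only [MonoidHom.comp_apply, WittVector.teichmuller_coeff_zero] at this
  exact (algebraMap (ZMod p) (kbar p)).injective this

lemma zocc1 (F : Submodule (kbar p) (Gp p → kbar p)) (hF : ZSimp (rT p) F) (a b c : ℕ)
    (hab : ¬ a ≡ b [MOD p - 1]) (h : ZOcc (rT p) F (IndS p b a c)) :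
    ZOcc (rT p) F (IndS p a b c) :=
  z_occ_transfer (rT p) hF (zTL p (zn1 p)) (zTL p (zn1 p)) (zTL_comm p _) (zTL_comm p _)
    (IndS_stab p a b c) (fun x hx => zT1_ind p _ _ _ _ x hx)
    (fun x hx h0 => zexact p (zn1 p) a b c b a c (fun φ hφ => zT1_ind p _ _ _ _ φ hφ)
      (fun φ hφ => zTT1 p _ (zteich_inj p) φ _ _ _ (fun h => hab h.symm) hφ) x hx h0) h

lemma zocc2 (F : Submodule (kbar p) (Gp p → kbar p)) (hF : ZSimp (rT p) F) (a b c : ℕ)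
    (hbc : ¬ b ≡ c [MOD p - 1]) (h : ZOcc (rT p) F (IndS p a c b)) :
    ZOcc (rT p) F (IndS p a b c) :=
  z_occ_transfer (rT p) hF (zTL p (zn2 p)) (zTL p (zn2 p)) (zTL_comm p _) (zTL_comm p _)
    (IndS_stab p a b c) (fun x hx => zT2_ind p _ _ _ _ x hx)
    (fun x hx h0 => zexact p (zn2 p) a b c a c b (fun φ hφ => zT2_ind p _ _ _ _ φ hφ)
      (fun φ hφ => zTT2 p _ (zteich_inj p) φ _ _ _ (fun h => hbc h.symm) hφ) x hx h0) h

lemma IndS_congr {a b c a' b' c' : ℕ} (ha : a ≡ a' [MOD p - 1]) (hb : b ≡ b' [MOD p - 1])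
    (hc : c ≡ c' [MOD p - 1]) : IndS p a b c = IndS p a' b' c' := by
  have key : ∀ x : ZMod p, x ≠ 0 → ∀ m n : ℕ, m ≡ n [MOD p - 1] →
      (algebraMap (ZMod p) (kbar p) x) ^ m = (algebraMap (ZMod p) (kbar p) x) ^ n := by
    intro x hx m n h
    rw [← map_pow, ← map_pow]
    congr 1
    have : orderOf (Units.mk0 x hx) ∣ p - 1 := orderOf_dvd_of_pow_eq_one (by
      ext; simpa using ZMod.pow_card_sub_one_eq_one hx)
    have := pow_eq_pow_iff_modEq.mpr (h.of_dvd this)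
    simpa using congrArg Units.val this
  ext f
  constructor
  · intro hf B g h1 h2 h3
    obtain ⟨e1, e2, e3⟩ := zdiag p B h1 h2 h3
    rw [hf B g h1 h2 h3, key _ e1 _ _ ha, key _ e2 _ _ hb, key _ e3 _ _ hc]
  · intro hf B g h1 h2 h3
    obtain ⟨e1, e2, e3⟩ := zdiag p B h1 h2 h3
    rw [hf B g h1 h2 h3, key _ e1 _ _ ha, key _ e2 _ _ hb, key _ e3 _ _ hc]

def zBor : Subgroup (Gp p) where
  carrier := {B | (B : Matrix (Fin 3) (Fin 3) (ZMod p)) 1 0 = 0 ∧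
    (B : Matrix (Fin 3) (Fin 3) (ZMod p)) 2 0 = 0 ∧
    (B : Matrix (Fin 3) (Fin 3) (ZMod p)) 2 1 = 0}
  one_mem' := by simp
  mul_mem' := by
    rintro A B ⟨h1, h2, h3⟩ ⟨h4, h5, h6⟩
    simp [Matrix.mul_apply, Fin.sum_univ_three, h1, h2, h3, h4, h5, h6]
  inv_mem' := by
    rintro A ⟨h1, h2, h3⟩
    obtain ⟨e1, e2, e3⟩ := zdiag p A h1 h2 h3
    have hA : (A⁻¹ : Gp p).val * A.val = 1 := by
      rw [← Units.val_mul]; simp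
    set N := (A⁻¹ : Gp p).val
    set M := A.val
    have e := fun i j => congrFun (congrFun hA i) j
    simp only [Matrix.mul_apply, Fin.sum_univ_three] at e
    have a1 : N 1 0 = 0 := by
      have := e 1 0
      simp [h1, h2] at this
      exact this.resolve_right e1
    have a2 : N 2 0 = 0 := by
      have := e 2 0
      simp [h1, h2] at this
      exact this.resolve_right e1
    have a3 : N 2 1 = 0 := by
      have := e 2 1
      simp [a2, h3] at this
      exact this.resolve_right e2
    exact ⟨a1, a2, a3⟩

lemma zBor_card : (p - 1) ^ 3 * p ^ 3 ≤ Nat.card (zBor p) := by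
  let F : ((ZMod p)ˣ × (ZMod p)ˣ × (ZMod p)ˣ) × (ZMod p × ZMod p × ZMod p) → zBor p :=
    fun z => ⟨GeneralLinearGroup.mkOfDetNeZero
      !![(z.1.1 : ZMod p), z.2.1, z.2.2.1; 0, (z.1.2.1 : ZMod p), z.2.2.2; 0, 0, (z.1.2.2 : ZMod p)]
      (by simp [det_fin_three]), by
        refine ⟨?_, ?_, ?_⟩ <;> simp [zmk_coe]⟩
  have hF : Function.Injective F := by
    rintro ⟨⟨a, b, c⟩, d, e, f⟩ ⟨⟨a', b', c'⟩, d', e', f'⟩ h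
    have h1 : ((F ⟨⟨a, b, c⟩, d, e, f⟩ : Gp p) : Matrix (Fin 3) (Fin 3) (ZMod p)) =
      (F ⟨⟨a', b', c'⟩, d', e', f'⟩ : Gp p) := by rw [h]
    simp only [F, zmk_coe] at h1
    have e' := fun i j => congrFun (congrFun h1 i) j
    have x1 := e' 0 0
    have x2 := e' 0 1
    have x3 := e' 0 2
    have x4 := e' 1 1
    have x5 := e' 1 2
    have x6 := e' 2 2
    simp at x1 x2 x3 x4 x5 x6
    subst x2 x3 x5
    rw [Units.ext x1, Units.ext x4, Units.ext x6]
  have := Nat.card_le_card_of_injective F hF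
  simp only [Nat.card_prod, Nat.card_eq_fintype_card (α := (ZMod p)ˣ), ZMod.card_units,
    Nat.card_zmod] at this
  calc _ = _ := by ring
    _ ≤ _ := this

lemma zIndS_dim (a b c : ℕ) : Module.finrank (kbar p) (IndS p a b c) ≤ (p + 1) * (p ^ 2 + p + 1) := by
  have hidx : (zBor p).index ≤ (p + 1) * (p ^ 2 + p + 1) := by
    have h1 := (zBor p).card_mul_index
    have h2 := zBor_card p
    have h3 : Nat.card (Gp p) = ((p - 1) ^ 3 * p ^ 3) * ((p + 1) * (p ^ 2 + p + 1)) := by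
      rw [Matrix.card_GL_field, Fin.prod_univ_three, ZMod.card]
      have hp := (Fact.out : p.Prime).two_le
      obtain ⟨m, rfl⟩ := Nat.exists_eq_add_of_le hp
      simp only [Fin.val_zero, Fin.val_one, Fin.val_two, pow_zero, pow_one]
      have e1 : (2 + m) ^ 3 - 1 = (m + 1) * ((2 + m) ^ 2 + (2 + m) + 1) := by
        apply Nat.sub_eq_of_eq_add; ring
      have e2 : (2 + m) ^ 3 - (2 + m) = (2 + m) * (m + 1) * (m + 3) := by
        apply Nat.sub_eq_of_eq_add; ring
      have e3 : (2 + m) ^ 3 - (2 + m) ^ 2 = (2 + m) ^ 2 * (m + 1) := by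
        apply Nat.sub_eq_of_eq_add; ring
      have e4 : 2 + m - 1 = m + 1 := by omega
      rw [e1, e2, e3, e4]; ring
    rw [h3] at h1
    have hpos : 0 < (p - 1) ^ 3 * p ^ 3 := by
      have hp := (Fact.out : p.Prime).two_le
      have : 0 < p - 1 := by omega
      positivity
    by_contra hcon
    push Not at hcon
    have := Nat.mul_lt_mul_of_le_of_lt h2 hcon (hpos.trans_le h2)
    omega
  refine le_trans ?_ hidx
  classical
  haveI : Fintype (Gp p ⧸ zBor p) := Fintype.ofFinite _
  let ev : IndS p a b c →ₗ[kbar p] ((Gp p ⧸ zBor p) → kbar p) :=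
    { toFun := fun f q => f.1 (q.out)⁻¹
      map_add' := fun _ _ => rfl
      map_smul' := fun _ _ => rfl }
  have hev : Function.Injective ev := by
    rw [← LinearMap.ker_eq_bot, LinearMap.ker_eq_bot']
    rintro ⟨f, hf⟩ h
    ext g
    show f g = 0
    obtain ⟨⟨β, hβ⟩, h1⟩ := QuotientGroup.mk_out_eq_mul (zBor p) g⁻¹
    have h2 := congrFun h (QuotientGroup.mk g⁻¹)
    have h3 : f (Quotient.out (QuotientGroup.mk (s := zBor p) g⁻¹))⁻¹ = 0 := h2
    rw [h1] at h3
    have h4 : g = β * (g⁻¹ * β)⁻¹ := by group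
    rw [h4, hf β _ hβ.1 hβ.2.1 hβ.2.2]
    simp only at h3
    rw [h3, mul_zero]
  have := LinearMap.finrank_le_finrank_of_injective hev
  rwa [Module.finrank_pi, ← Nat.card_eq_fintype_card] at this

section PolyA
variable {K : Type*} [Field K] [Algebra (ZMod p) K]
open MvPolynomial

abbrev ZI := Fin 3 ⊕ Fin 3
def zw : ZI → ℕ × ℕ := Sum.elim (fun _ => (1, 0)) (fun _ => (0, 1))

lemma zw_weight (d : ZI →₀ ℕ) :
    Finsupp.weight zw d = (∑ i, d (Sum.inl i), ∑ i, d (Sum.inr i)) := by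
  rw [Finsupp.weight_apply, Finsupp.sum_fintype _ _ (by simp)]
  simp only [Fintype.sum_sum_type, zw, Sum.elim_inl, Sum.elim_inr]
  simp [Fin.sum_univ_three]

variable (K) in
def QQ (r s : ℕ) : Submodule K (MvPolynomial ZI K) := weightedHomogeneousSubmodule K zw (r, s)

lemma mem_QQ {r s : ℕ} {P : MvPolynomial ZI K} :
    P ∈ QQ K r s ↔ IsWeightedHomogeneous zw P (r, s) := Iff.rfl

noncomputable def PP (η ξ : Fin 3 → K) (r s : ℕ) : MvPolynomial ZI K :=
  (∑ i, C (η i) * X (Sum.inl i)) ^ r * (∑ i, C (ξ i) * X (Sum.inr i)) ^ s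

lemma PP_mem (η ξ : Fin 3 → K) (r s : ℕ) : PP η ξ r s ∈ QQ K r s := by
  rw [mem_QQ]
  have h1 : IsWeightedHomogeneous zw (∑ i, C (η i) * X (Sum.inl i) : MvPolynomial ZI K) (1, 0) :=
    IsWeightedHomogeneous.sum _ _ _ fun i _ => (isWeightedHomogeneous_X K zw (Sum.inl i)).C_mul _
  have h2 : IsWeightedHomogeneous zw (∑ i, C (ξ i) * X (Sum.inr i) : MvPolynomial ZI K) (0, 1) :=
    IsWeightedHomogeneous.sum _ _ _ fun i _ => (isWeightedHomogeneous_X K zw (Sum.inr i)).C_mul _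
  have := (h1.pow r).mul (h2.pow s)
  simpa [PP] using this

lemma PP_eval (η ξ : Fin 3 → K) (r s : ℕ) (x y : Fin 3 → K) :
    eval (Sum.elim x y) (PP η ξ r s) = (∑ i, η i * x i) ^ r * (∑ i, ξ i * y i) ^ s := by
  simp [PP]

lemma PP_symm (η ξ : Fin 3 → K) (r s : ℕ) (x y : Fin 3 → K) :
    eval (Sum.elim x y) (PP η ξ r s) = eval (Sum.elim η ξ) (PP x y r s) := by
  simp [PP_eval, mul_comm]

lemma QQ_basis_card (r s : ℕ) : Nat.card {d : ZI →₀ ℕ | Finsupp.weight zw d = (r, s)} =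
    (r + 2).choose 2 * (s + 2).choose 2 := by
  have e : {d : ZI →₀ ℕ | Finsupp.weight zw d = (r, s)} ≃
      {P : Fin 3 → ℕ // ∑ i, P i = r} × {P : Fin 3 → ℕ // ∑ i, P i = s} :=
    { toFun := fun d => (⟨fun i => d.1 (Sum.inl i), by
          have := d.2; simp only [Set.mem_setOf_eq, zw_weight] at this
          exact congrArg Prod.fst this⟩, ⟨fun i => d.1 (Sum.inr i), by
          have := d.2; simp only [Set.mem_setOf_eq, zw_weight] at this
          exact congrArg Prod.snd this⟩)
      invFun := fun q => ⟨Finsupp.equivFunOnFinite.symm (Sum.elim q.1.1 q.2.1), by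
          simp [zw_weight, q.1.2, q.2.2]⟩
      left_inv := by
        rintro ⟨d, hd⟩
        apply Subtype.ext
        ext i
        rcases i with i | i <;> simp
      right_inv := by
        rintro ⟨⟨a, ha⟩, ⟨b, hb⟩⟩
        simp }
  have c1 : ∀ r, Nat.card {P : Fin 3 → ℕ // ∑ i, P i = r} = (r + 2).choose 2 := by
    intro r
    rw [← Nat.card_congr (Sym.equivNatSumOfFintype (Fin 3) r), Nat.card_eq_fintype_card,
      Sym.card_sym_eq_choose, Fintype.card_fin]
    have : 3 + r - 1 = r + 2 := by omega
    rw [this, Nat.choose_symm_add]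
  rw [Nat.card_congr e, Nat.card_prod, c1, c1]

instance QQ_fin (r s : ℕ) : Module.Finite K (QQ K r s) := by
  have : Finite {d : ZI →₀ ℕ | Finsupp.weight zw d = (r, s)} := by
    apply Nat.finite_of_card_ne_zero
    rw [QQ_basis_card]
    have h1 := Nat.choose_pos (show 2 ≤ r + 2 by omega)
    have h2 := Nat.choose_pos (show 2 ≤ s + 2 by omega)
    positivity
  rw [QQ, weightedHomogeneousSubmodule_eq_finsupp_supported]
  exact Module.Finite.of_basis (basisRestrictSupport K {d | Finsupp.weight zw d = (r, s)})

lemma QQ_finrank (r s : ℕ) : Module.finrank K (QQ K r s) = (r + 2).choose 2 * (s + 2).choose 2 := by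
  rw [QQ, weightedHomogeneousSubmodule_eq_finsupp_supported]
  exact (Module.finrank_eq_nat_card_basis
    (basisRestrictSupport K {d | Finsupp.weight zw d = (r, s)})).trans (QQ_basis_card r s)

lemma QQ_eq_zero {r s : ℕ} (hr : r < p) (hs : s < p) {P : MvPolynomial ZI K} (hP : P ∈ QQ K r s)
    (h : ∀ η ξ : Fin 3 → ZMod p, eval (Sum.elim (fun i => algebraMap (ZMod p) K (η i))
      (fun i => algebraMap (ZMod p) K (ξ i))) P = 0) : P = 0 := by
  classical
  have hinj : Function.Injective (algebraMap (ZMod p) K) := (algebraMap (ZMod p) K).injective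
  have hp0 : 0 < p := by omega
  apply eq_zero_of_eval_zero_at_prod_finset P
    (fun _ => Finset.univ.image (algebraMap (ZMod p) K))
  · intro i
    rw [Finset.card_image_of_injective _ hinj, Finset.card_univ, ZMod.card, degreeOf_lt_iff hp0]
    intro m hm
    have := hP (mem_support_iff.mp hm)
    rw [zw_weight] at this
    have h1 : ∑ i, m (Sum.inl i) = r := congrArg Prod.fst this
    have h2 : ∑ i, m (Sum.inr i) = s := congrArg Prod.snd this
    rcases i with i | i
    · have := Finset.single_le_sum (f := fun i => m (Sum.inl i)) (fun _ _ => Nat.zero_le _)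
        (Finset.mem_univ i)
      omega
    · have := Finset.single_le_sum (f := fun i => m (Sum.inr i)) (fun _ _ => Nat.zero_le _)
        (Finset.mem_univ i)
      omega
  · intro x hx
    simp only [Finset.mem_image, Finset.mem_univ, true_and] at hx
    choose z hz using hx
    have := h (fun i => z (Sum.inl i)) (fun i => z (Sum.inr i))
    convert this using 2
    congr 1
    funext i
    rcases i with i | i <;> simp [hz]

lemma zmultinom {r : ℕ} (hr : r < p) (κ : Fin 3 → ℕ) (hκ : ∑ i, κ i = r) :
    ((Nat.multinomial Finset.univ κ : ℕ) : K) ≠ 0 := by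
  intro h
  have : CharP K p := charP_of_injective_algebraMap (algebraMap (ZMod p) K).injective p
  rw [CharP.cast_eq_zero_iff K p] at h
  have h1 := Nat.multinomial_spec Finset.univ κ
  rw [hκ] at h1
  have h2 : p ∣ r.factorial := h1 ▸ (h.mul_left _)
  have := ((Fact.out : p.Prime).dvd_factorial).mp h2
  omega

lemma PP_expand (η ξ : Fin 3 → K) (r s : ℕ) :
    PP η ξ r s = ∑ κ ∈ Finset.piAntidiag Finset.univ r, ∑ l ∈ Finset.piAntidiag Finset.univ s,
      (((Nat.multinomial Finset.univ κ : ℕ) : K) * ((Nat.multinomial Finset.univ l : ℕ) : K) *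
      ((∏ i, η i ^ κ i) * (∏ i, ξ i ^ l i))) •
        ((∏ i, X (Sum.inl i) ^ κ i) * (∏ i, X (Sum.inr i) ^ l i)) := by
  rw [PP, Finset.sum_pow_eq_sum_piAntidiag, Finset.sum_pow_eq_sum_piAntidiag, Finset.sum_mul_sum]
  refine Finset.sum_congr rfl fun κ _ => Finset.sum_congr rfl fun l _ => ?_
  rw [smul_eq_C_mul]
  simp only [mul_pow, Finset.prod_mul_distrib, map_mul, map_prod, map_pow, map_natCast]
  ring

noncomputable def zexp (κ l : Fin 3 → ℕ) : ZI →₀ ℕ := Finsupp.equivFunOnFinite.symm (Sum.elim κ l)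

lemma zmono (κ l : Fin 3 → ℕ) : 
    ((∏ i, X (Sum.inl i) ^ κ i) * (∏ i, X (Sum.inr i) ^ l i) : MvPolynomial ZI K) =
    monomial (zexp κ l) 1 := by
  rw [monomial_eq, Finsupp.prod_fintype _ _ (by simp)]
  simp [zexp, Fintype.sum_sum_type]

lemma zexp_inj {κ l κ' l' : Fin 3 → ℕ} (h : zexp κ l = zexp κ' l') : κ = κ' ∧ l = l' := by
  have := Finsupp.equivFunOnFinite.symm.injective h
  constructor
  · funext i; exact congrFun this (Sum.inl i)
  · funext i; exact congrFun this (Sum.inr i)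

lemma zexp_surj (d : ZI →₀ ℕ) : d = zexp (fun i => d (Sum.inl i)) (fun i => d (Sum.inr i)) := by
  ext i; rcases i with i | i <;> simp [zexp]

lemma QQ_span {r s : ℕ} (hr : r < p) (hs : s < p) :
    QQ K r s = Submodule.span K (Set.range (fun z : (Fin 3 → ZMod p) × (Fin 3 → ZMod p) =>
      PP (fun i => algebraMap (ZMod p) K (z.1 i)) (fun i => algebraMap (ZMod p) K (z.2 i)) r s)) := by
  classical
  apply le_antisymm
  · intro P hP
    by_contra hcon
    obtain ⟨ℓ, hℓP, hℓ⟩ := Submodule.exists_le_ker_of_notMem hcon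
    apply hℓP
    set R : MvPolynomial ZI K := ∑ κ ∈ Finset.piAntidiag Finset.univ r,
      ∑ l ∈ Finset.piAntidiag Finset.univ s,
      (((Nat.multinomial Finset.univ κ : ℕ) : K) * ((Nat.multinomial Finset.univ l : ℕ) : K) *
       ℓ (monomial (zexp κ l) 1)) • monomial (zexp κ l) (1 : K) with hR
    have hRQ : R ∈ QQ K r s := by
      refine Submodule.sum_mem _ fun κ hκ => Submodule.sum_mem _ fun l hl => Submodule.smul_mem _ _ ?_
      apply isWeightedHomogeneous_monomial
      rw [zw_weight]
      simp only [Finset.mem_piAntidiag] at hκ hl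
      simp [zexp, hκ.1, hl.1]
    have hR0 : R = 0 := by
      apply QQ_eq_zero p hr hs hRQ
      intro η ξ
      have h1 : ℓ (PP (fun i => algebraMap (ZMod p) K (η i)) (fun i => algebraMap (ZMod p) K (ξ i)) r s) = 0 :=
        hℓ (Submodule.subset_span ⟨(η, ξ), rfl⟩)
      rw [← h1, PP_expand]
      simp only [hR, map_sum, map_smul, smul_eq_mul, zmono, smul_eval]
      refine Finset.sum_congr rfl fun κ _ => Finset.sum_congr rfl fun l _ => ?_
      rw [← zmono]
      simp
      ring
    have hmono : ∀ d : ZI →₀ ℕ, Finsupp.weight zw d = (r, s) → ℓ (monomial d 1) = 0 := by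
      intro d hd
      rw [zw_weight] at hd
      have h1 : ∑ i, d (Sum.inl i) = r := congrArg Prod.fst hd
      have h2 : ∑ i, d (Sum.inr i) = s := congrArg Prod.snd hd
      have hc := congrArg (coeff d) hR0
      rw [hR, zexp_surj d] at hc
      simp only [coeff_sum, coeff_smul, coeff_monomial, coeff_zero] at hc
      rw [Finset.sum_eq_single (fun i => d (Sum.inl i)), Finset.sum_eq_single (fun i => d (Sum.inr i))] at hc
      · simp only [if_true, smul_eq_mul, mul_one] at hc
        rw [← zexp_surj] at hc
        have := mul_ne_zero (zmultinom (K := K) p hr _ h1) (zmultinom (K := K) p hs _ h2)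
        exact (mul_eq_zero.mp hc).resolve_left this
      · intro l _ hl
        rw [if_neg]; · simp
        intro h; exact hl (zexp_inj h).2
      · intro h; exfalso; apply h; simp [h2]
      · intro κ _ hκ
        apply Finset.sum_eq_zero
        intro l _
        rw [if_neg]; · simp
        intro h; exact hκ (zexp_inj h).1
      · intro h; exfalso; apply h; simp [h1]
    rw [P.as_sum, map_sum]
    apply Finset.sum_eq_zero
    intro d hd
    have := hmono d (hP (mem_support_iff.mp hd))
    have h2 : (monomial d (coeff d P)) = (coeff d P) • (monomial d (1 : K)) := by
      rw [smul_monomial, smul_eq_mul, mul_one]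
    rw [h2, map_smul, this, smul_zero]
  · rw [Submodule.span_le]
    rintro _ ⟨z, rfl⟩
    exact PP_mem _ _ _ _
end PolyA

section PolyB
variable {K : Type*} [Field K] [Algebra (ZMod p) K]
open MvPolynomial

variable (K) in
noncomputable def zf : MvPolynomial ZI K := ∑ i, X (Sum.inl i) * X (Sum.inr i)

lemma zf_mem : IsWeightedHomogeneous zw (zf K) (1, 1) :=
  IsWeightedHomogeneous.sum _ _ _ fun i _ =>
    (isWeightedHomogeneous_X K zw (Sum.inl i)).mul (isWeightedHomogeneous_X K zw (Sum.inr i))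

lemma zf_eval (x y : Fin 3 → K) : eval (Sum.elim x y) (zf K) = ∑ i, x i * y i := by
  simp [zf]

lemma zf_ne : zf K ≠ 0 := by
  intro h
  have := zf_eval (K := K) (fun _ => 1) (Pi.single 0 1)
  rw [h] at this
  simp at this

lemma zf_dvd {r s : ℕ} {P : MvPolynomial ZI K} (hP : P ∈ QQ K (r + 1) (s + 1)) (h : zf K ∣ P) :
    ∃ R ∈ QQ K r s, P = zf K * R := by
  classical
  obtain ⟨R, rfl⟩ := h
  letI := weightedGradedAlgebra K zw
  refine ⟨_, (DirectSum.decompose (weightedHomogeneousSubmodule K zw) R (r, s)).2, ?_⟩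
  have h1 := DirectSum.coe_decompose_mul_add_of_left_mem (weightedHomogeneousSubmodule K zw)
    (i := (1, 1)) (j := (r, s)) (b := R) (zf_mem (K := K))
  have h2 : ((1, 1) + (r, s) : ℕ × ℕ) = (r + 1, s + 1) := by ext <;> simp [add_comm]
  rw [h2] at h1
  have h3 := DirectSum.decompose_of_mem_same (weightedHomogeneousSubmodule K zw) hP
  rw [h3] at h1
  exact h1

lemma zf_dvd_zero {r s : ℕ} {P : MvPolynomial ZI K} (hP : P ∈ QQ K r s) (h : zf K ∣ P)
    (hrs : r = 0 ∨ s = 0) : P = 0 := by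
  classical
  obtain ⟨R, rfl⟩ := h
  letI := weightedGradedAlgebra K zw
  have h1 := DirectSum.coe_decompose_mul_of_left_mem_of_not_le (weightedHomogeneousSubmodule K zw)
    (i := (1, 1)) (n := (r, s)) (b := R) (zf_mem (K := K)) (by
      rw [Prod.mk_le_mk]; rcases hrs with h | h <;> omega)
  rw [DirectSum.decompose_of_mem_same (weightedHomogeneousSubmodule K zw) hP] at h1
  exact h1

lemma zf_mul_mem {r s : ℕ} {R : MvPolynomial ZI K} (hR : R ∈ QQ K r s) :
    zf K * R ∈ QQ K (r + 1) (s + 1) := by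
  have := zf_mem.mul (mem_QQ.mp hR)
  have h2 : ((1, 1) + (r, s) : ℕ × ℕ) = (r + 1, s + 1) := by ext <;> simp [add_comm]
  rwa [h2] at this

lemma zf_prime : Prime (zf K) := by
  rw [← UniqueFactorizationMonoid.irreducible_iff_prime]
  have h : zf K = sumSMulXSMulY (Finsupp.equivFunOnFinite.symm (fun _ : Fin 3 => (1 : K))) := by
    rw [sumSMulXSMulY, Finsupp.linearCombination_apply, Finsupp.sum_fintype _ _ (by simp)]
    simp [zf]
  rw [h]
  apply irreducible_sumSMulXSMulY
  · refine ⟨0, by simp, 1, by simp, by decide⟩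
  · intro r hr
    have := hr 0
    simpa using isUnit_of_dvd_one this

lemma zf_null [IsAlgClosed K] {P : MvPolynomial ZI K}
    (h : ∀ x y : Fin 3 → K, x 0 ≠ 0 → y 2 ≠ 0 → ∑ i, x i * y i = 0 → eval (Sum.elim x y) P = 0) :
    zf K ∣ P := by
  have hI : (Ideal.span {zf K}).IsPrime := by
    rw [Ideal.span_singleton_prime zf_ne]; exact zf_prime
  have key : X (Sum.inl 0) * (X (Sum.inr 2) * P) ∈ Ideal.span {zf K} := by
    rw [← IsPrime.vanishingIdeal_zeroLocus (K := K) (Ideal.span {zf K})]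
    rw [mem_vanishingIdeal_iff]
    intro z hz
    rw [mem_zeroLocus_iff] at hz
    have h0 := hz _ (Ideal.mem_span_singleton_self _)
    have hz' : z = Sum.elim (fun i => z (Sum.inl i)) (fun i => z (Sum.inr i)) := by
      funext i; rcases i with i | i <;> rfl
    rw [aeval_eq_eval] at h0 ⊢
    have h0' : eval (Sum.elim (fun i => z (Sum.inl i)) (fun i => z (Sum.inr i))) (zf K) = 0 := by
      rw [← hz']; exact h0
    rw [zf_eval] at h0'
    show eval z _ = 0
    by_cases hx : z (Sum.inl 0) = 0
    · simp [hx]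
    by_cases hy : z (Sum.inr 2) = 0
    · simp [hy]
    have := h _ _ hx hy h0'
    rw [← hz'] at this
    simp [this]
  have hX : (X (Sum.inl 0) : MvPolynomial ZI K) ∉ Ideal.span {zf K} := by
    rw [Ideal.mem_span_singleton]
    rintro ⟨R, hR⟩
    have h1 := congrArg (eval (Sum.elim (Pi.single 0 (1 : K)) (0 : Fin 3 → K))) hR
    rw [map_mul, zf_eval] at h1
    simp at h1
  have hY : (X (Sum.inr 2) : MvPolynomial ZI K) ∉ Ideal.span {zf K} := by
    rw [Ideal.mem_span_singleton]
    rintro ⟨R, hR⟩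
    have h1 := congrArg (eval (Sum.elim (0 : Fin 3 → K) (Pi.single 2 (1 : K)))) hR
    rw [map_mul, zf_eval] at h1
    simp at h1
  rw [← Ideal.mem_span_singleton]
  exact (hI.mem_or_mem ((hI.mem_or_mem key).resolve_left hX)).resolve_left hY

variable (K) in
noncomputable def zD : MvPolynomial ZI K →ₗ[K] MvPolynomial ZI K :=
  ∑ i : Fin 3, (pderiv (Sum.inl i)).toLinearMap ∘ₗ (pderiv (Sum.inr i)).toLinearMap

lemma zD_apply (P : MvPolynomial ZI K) :
    zD K P = ∑ i : Fin 3, pderiv (Sum.inl i) (pderiv (Sum.inr i) P) := by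
  simp [zD]

lemma zD_mem {r s : ℕ} {P : MvPolynomial ZI K} (hP : P ∈ QQ K (r + 1) (s + 1)) :
    zD K P ∈ QQ K r s := by
  rw [zD_apply]
  refine Submodule.sum_mem _ fun i _ => ?_
  have h1 : IsWeightedHomogeneous zw (pderiv (Sum.inr i) P) (r + 1, s) :=
    (mem_QQ.mp hP).pderiv (by simp [zw])
  exact h1.pderiv (by simp [zw])

lemma zpd_zero {i : ZI} {P : MvPolynomial ZI K} (hi : ∀ d : ZI →₀ ℕ, coeff d P ≠ 0 → d i = 0) :
    pderiv i P = 0 := by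
  apply pderiv_eq_zero_of_notMem_vars
  intro hm
  rw [mem_vars] at hm
  obtain ⟨d, hd, hdi⟩ := hm
  have := hi d (mem_support_iff.mp hd)
  simp [this] at hdi

lemma zD_zero {r s : ℕ} {P : MvPolynomial ZI K} (hP : P ∈ QQ K r s) (h : r = 0 ∨ s = 0) :
    zD K P = 0 := by
  rw [zD_apply]
  apply Finset.sum_eq_zero
  intro i _
  rcases Nat.eq_zero_or_pos s with rfl | hs
  · rw [zpd_zero (i := Sum.inr i), map_zero]
    intro d hd
    have := hP hd
    rw [zw_weight] at this
    have h1 : ∑ i, d (Sum.inr i) = 0 := congrArg Prod.snd this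
    rw [Finset.sum_eq_zero_iff] at h1
    exact h1 i (Finset.mem_univ i)
  · obtain ⟨s, rfl⟩ := Nat.exists_eq_succ_of_ne_zero hs.ne'
    have hr : r = 0 := h.resolve_right (by omega)
    subst hr
    have h1 : IsWeightedHomogeneous zw (pderiv (Sum.inr i) P) (0, s) :=
      (mem_QQ.mp hP).pderiv (by simp [zw])
    apply zpd_zero
    intro d hd
    have := h1 hd
    rw [zw_weight] at this
    have h1 : ∑ i, d (Sum.inl i) = 0 := congrArg Prod.fst this
    rw [Finset.sum_eq_zero_iff] at h1
    exact h1 i (Finset.mem_univ i)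

lemma QQ_homog {r s : ℕ} {P : MvPolynomial ZI K} (hP : P ∈ QQ K r s) : P.IsHomogeneous (r + s) := by
  intro d hd
  have := hP hd
  rw [zw_weight] at this
  have h1 : ∑ i, d (Sum.inl i) = r := congrArg Prod.fst this
  have h2 : ∑ i, d (Sum.inr i) = s := congrArg Prod.snd this
  rw [Finsupp.weight_apply, Finsupp.sum_fintype _ _ (by simp)]
  simp [Fintype.sum_sum_type, h1, h2]

lemma zD_f {r s : ℕ} {g : MvPolynomial ZI K} (hg : g ∈ QQ K r s) :
    zD K (zf K * g) = zf K * zD K g + ((r + s + 3 : ℕ) : K) • g := by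
  have hE := (QQ_homog hg).sum_X_mul_pderiv
  rw [Fintype.sum_sum_type] at hE
  have hy : ∀ i : Fin 3, pderiv (Sum.inr i) (zf K) = X (Sum.inl i) := by
    intro i
    simp [zf, Derivation.leibniz, pderiv_X, Pi.single_apply]
  have hx : ∀ i : Fin 3, pderiv (Sum.inl i) (zf K) = X (Sum.inr i) := by
    intro i
    simp [zf, Derivation.leibniz, pderiv_X, Pi.single_apply]
  have h1 : ∀ i : Fin 3, pderiv (Sum.inl i) (pderiv (Sum.inr i) (zf K * g)) =
      g + X (Sum.inl i) * pderiv (Sum.inl i) g + X (Sum.inr i) * pderiv (Sum.inr i) g + 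
      zf K * pderiv (Sum.inl i) (pderiv (Sum.inr i) g) := by
    intro i
    rw [Derivation.leibniz, hy, map_add, smul_eq_mul, smul_eq_mul, Derivation.leibniz,
      Derivation.leibniz, hx, pderiv_X_self]
    simp only [smul_eq_mul]
    ring
  rw [zD_apply, zD_apply, Finset.sum_congr rfl fun i _ => h1 i]
  simp only [Finset.sum_add_distrib, ← Finset.mul_sum]
  rw [Finset.sum_const, Finset.card_univ, Fintype.card_fin, Nat.cast_smul_eq_nsmul]
  have : (r + s + 3) • g = (r + s) • g + 3 • g := by rw [add_smul]
  rw [this, ← hE]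
  ring

lemma zD_PP (η ξ : Fin 3 → K) (r s : ℕ) :
    zD K (PP η ξ (r + 1) (s + 1)) = ((r + 1 : K) * (s + 1) * ∑ i, η i * ξ i) • PP η ξ r s := by
  set A : MvPolynomial ZI K := ∑ i, C (η i) * X (Sum.inl i) with hA
  set B : MvPolynomial ZI K := ∑ i, C (ξ i) * X (Sum.inr i) with hB
  have hAx : ∀ i : Fin 3, pderiv (Sum.inl i) A = C (η i) := by
    intro i; simp [hA, Derivation.leibniz, pderiv_X, Pi.single_apply]
  have hAy : ∀ i : Fin 3, pderiv (Sum.inr i) A = 0 := by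
    intro i; simp [hA, Derivation.leibniz, pderiv_X, Pi.single_apply]
  have hBx : ∀ i : Fin 3, pderiv (Sum.inl i) B = 0 := by
    intro i; simp [hB, Derivation.leibniz, pderiv_X, Pi.single_apply]
  have hBy : ∀ i : Fin 3, pderiv (Sum.inr i) B = C (ξ i) := by
    intro i; simp [hB, Derivation.leibniz, pderiv_X, Pi.single_apply]
  have h1 : ∀ i : Fin 3, pderiv (Sum.inl i) (pderiv (Sum.inr i) (A ^ (r + 1) * B ^ (s + 1))) =
      C ((r + 1 : K) * (s + 1)) * (C (η i) * C (ξ i)) * (A ^ r * B ^ s) := by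
    intro i
    simp only [Derivation.leibniz, Derivation.leibniz_pow, hAx, hAy, hBx, hBy, smul_eq_mul,
      map_add, map_zero, mul_zero, smul_zero, zero_add, add_zero, pderiv_C, map_nsmul, map_mul, map_one, map_natCast,
      nsmul_eq_mul, Nat.cast_add, Nat.cast_one, Nat.add_sub_cancel, Derivation.map_natCast,
      Derivation.map_one_eq_zero]
    ring
  rw [zD_apply, PP, ← hA, ← hB, Finset.sum_congr rfl fun i _ => h1 i, PP, ← hA, ← hB,
    smul_eq_C_mul, ← Finset.sum_mul, ← Finset.mul_sum]
  simp only [map_mul, map_sum]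
end PolyB

section PolyC
variable {K : Type*} [Field K] [Algebra (ZMod p) K]

lemma zcharK : CharP K p := charP_of_injective_algebraMap (algebraMap (ZMod p) K).injective p

lemma zfix1 {V : Type*} [AddCommGroup V] [Module K V] (σ : Module.End K V) (hσ : σ ^ p = 1)
    (N : Submodule K V) (hN : N ≠ ⊥) (hs : ∀ v ∈ N, σ v ∈ N) : ∃ v ∈ N, v ≠ 0 ∧ σ v = v := by
  classical
  haveI : CharP K p := zcharK p
  have h0 : (σ - 1 : Module.End K V) ^ p = 0 := by
    have h1 : ((Polynomial.X : Polynomial K) - 1) ^ p = Polynomial.X ^ p - 1 := by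
      rw [sub_pow_char, one_pow]
    have h2 := congrArg (Polynomial.aeval σ) h1
    simpa [hσ] using h2
  obtain ⟨v, hv, hv0⟩ := (Submodule.ne_bot_iff _).mp hN
  have hex : ∃ n, ((σ - 1 : Module.End K V) ^ n) v = 0 := ⟨p, by rw [h0]; rfl⟩
  have hmem : ∀ n, ((σ - 1 : Module.End K V) ^ n) v ∈ N := by
    intro n
    induction n with
    | zero => simpa using hv
    | succ n ih =>
      rw [pow_succ']
      show σ (((σ - 1 : Module.End K V) ^ n) v) - ((σ - 1 : Module.End K V) ^ n) v ∈ N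
      exact N.sub_mem (hs _ ih) ih
  have hn := Nat.find_spec hex
  have hpos : Nat.find hex ≠ 0 := by
    intro h
    rw [h] at hn
    exact hv0 (by simpa using hn)
  obtain ⟨m, hm⟩ := Nat.exists_eq_succ_of_ne_zero hpos
  refine ⟨((σ - 1 : Module.End K V) ^ m) v, hmem m, Nat.find_min hex (by omega), ?_⟩
  rw [hm, Nat.succ_eq_add_one, pow_succ'] at hn
  have : σ (((σ - 1 : Module.End K V) ^ m) v) - ((σ - 1 : Module.End K V) ^ m) v = 0 := hn
  exact sub_eq_zero.mp this

lemma zfix3 {V : Type*} [AddCommGroup V] [Module K V] (a b c : Module.End K V) (ha : a ^ p = 1)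
    (hb : b ^ p = 1) (hc : c ^ p = 1) (hca : ∀ v, c (a v) = a (c v)) (hcb : ∀ v, c (b v) = b (c v))
    (hab : ∀ v, c v = v → a (b v) = b (a v))
    (N : Submodule K V) (hN : N ≠ ⊥) (hNa : ∀ v ∈ N, a v ∈ N) (hNb : ∀ v ∈ N, b v ∈ N)
    (hNc : ∀ v ∈ N, c v ∈ N) : ∃ v ∈ N, v ≠ 0 ∧ a v = v ∧ b v = v ∧ c v = v := by
  obtain ⟨v1, hv1, hv10, hv1c⟩ := zfix1 p c hc N hN hNc
  let N1 : Submodule K V := N ⊓ LinearMap.ker (c - 1)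
  have m1 : ∀ v, v ∈ N1 ↔ v ∈ N ∧ c v = v := by
    intro v
    simp [N1, sub_eq_zero]
  obtain ⟨v2, hv2, hv20, hv2a⟩ := zfix1 p a ha N1 (by
      rw [Submodule.ne_bot_iff]; exact ⟨v1, (m1 _).mpr ⟨hv1, hv1c⟩, hv10⟩) (by
      intro v hv
      rw [m1] at hv ⊢
      exact ⟨hNa v hv.1, by rw [hca, hv.2]⟩)
  let N2 : Submodule K V := N1 ⊓ LinearMap.ker (a - 1)
  have m2 : ∀ v, v ∈ N2 ↔ (v ∈ N ∧ c v = v) ∧ a v = v := by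
    intro v
    simp [N2, m1, sub_eq_zero]
  obtain ⟨v3, hv3, hv30, hv3b⟩ := zfix1 p b hb N2 (by
      rw [Submodule.ne_bot_iff]; exact ⟨v2, (m2 _).mpr ⟨(m1 _).mp hv2, hv2a⟩, hv20⟩) (by
      intro v hv
      rw [m2] at hv ⊢
      exact ⟨⟨hNb v hv.1.1, by rw [hcb, hv.1.2]⟩, by rw [hab v hv.1.2, hv.2]⟩)
  rw [m2] at hv3
  exact ⟨v3, hv3.1.1, hv30, hv3.2, hv3b, hv3.1.2⟩

open Polynomial in
lemma zper_vals (q : K[X]) (h : ∀ t, q.eval (t + 1) = q.eval t) (z : ZMod p) :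
    q.eval (algebraMap (ZMod p) K z) = q.eval 0 := by
  have hn : ∀ n : ℕ, q.eval (n : K) = q.eval 0 := by
    intro n
    induction n with
    | zero => simp
    | succ n ih => rw [Nat.cast_succ, h, ih]
  have := hn z.val
  rwa [← map_natCast (algebraMap (ZMod p) K), ZMod.natCast_zmod_val] at this

open Polynomial in
lemma zvan (q : K[X]) (hd : q.natDegree < p) (h : ∀ z : ZMod p, q.eval (algebraMap (ZMod p) K z) = 0) :
    q = 0 := by
  apply Polynomial.eq_zero_of_natDegree_lt_card_of_eval_eq_zero q
    (algebraMap (ZMod p) K).injective h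
  rwa [ZMod.card]

open Polynomial in
lemma zper (q : K[X]) (hd : q.natDegree < p) (h : ∀ t, q.eval (t + 1) = q.eval t) (t : K) :
    q.eval t = q.eval 0 := by
  have h1 : q - C (q.eval 0) = 0 := by
    apply zvan p
    · rwa [natDegree_sub_C]
    · intro z; simp [zper_vals p q h z]
  have := congrArg (Polynomial.eval t) h1
  simpa [sub_eq_zero] using this

open Polynomial in
lemma zper2 [Infinite K] (q : K[X]) (hd : q.natDegree < 2 * p) (h : ∀ t, q.eval (t + 1) = q.eval t) :
    ∃ A B : K, ∀ t, q.eval t = A + B * (t ^ p - t) := by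
  haveI : CharP K p := zcharK p
  have hp := (Fact.out : p.Prime).two_le
  set m : K[X] := X ^ p - X with hm
  have hmm : m.Monic := monic_X_pow_sub (by rw [degree_X]; exact_mod_cast (by omega : 1 < p))
  have hmd : m.natDegree = p := by
    rw [hm]; apply natDegree_eq_of_degree_eq_some
    rw [degree_sub_eq_left_of_degree_lt] <;> rw [degree_X_pow]
    rw [degree_X]; exact_mod_cast (by omega : 1 < p)
  set q0 := q - C (q.eval 0) with hq0
  have hq0d : q0.natDegree < 2 * p := by rwa [hq0, natDegree_sub_C]
  have hm1 : m ≠ 1 := by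
    intro h; rw [h] at hmd; simp at hmd; omega
  have hmev : ∀ z : ZMod p, m.eval (algebraMap (ZMod p) K z) = 0 := by
    intro z; simp [hm, ← map_pow]
  have hmod : q0 %ₘ m = 0 := by
    apply zvan p
    · have := natDegree_modByMonic_lt q0 hmm hm1
      rwa [hmd] at this
    · intro z
      have h1 := congrArg (Polynomial.eval (algebraMap (ZMod p) K z)) (modByMonic_add_div q0 m)
      rw [eval_add, eval_mul, hmev z, zero_mul, add_zero] at h1
      rw [h1]; simp [hq0, zper_vals p q h z]
  have hdiv : m * (q0 /ₘ m) = q0 := by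
    have := modByMonic_add_div q0 m
    rwa [hmod, zero_add] at this
  set hh := q0 /ₘ m with hhh
  have hhd : hh.natDegree < p := by
    rw [hhh, natDegree_divByMonic q0 hmm, hmd]; omega
  have hper : hh.comp (X + 1) = hh := by
    have h1 : m * (hh.comp (X + 1) - hh) = 0 := by
      apply Polynomial.funext
      intro t
      have e1 := congrArg (Polynomial.eval t) hdiv
      have e2 := congrArg (Polynomial.eval (t + 1)) hdiv
      simp only [eval_mul, hm, hq0, eval_sub, eval_pow, eval_X, eval_C, h t] at e1 e2
      rw [add_pow_char, one_pow] at e2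
      simp only [eval_mul, hm, eval_sub, eval_pow, eval_X, eval_comp, eval_add, eval_one, eval_zero]
      linear_combination e2 - e1
    have := (mul_eq_zero.mp h1).resolve_left hmm.ne_zero
    exact sub_eq_zero.mp this
  have hconst := zper p hh hhd (fun t => by
    have := congrArg (Polynomial.eval t) hper
    simpa [eval_comp] using this)
  refine ⟨q.eval 0, hh.eval 0, fun t => ?_⟩
  have e1 := congrArg (Polynomial.eval t) hdiv
  simp only [eval_mul, hm, hq0, eval_sub, eval_pow, eval_X, eval_C, hconst t] at e1
  linear_combination -e1

def ZPd (n : ℕ) (F : K → K) : Prop := ∃ q : Polynomial K, q.natDegree ≤ n ∧ ∀ t, q.eval t = F t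

open MvPolynomial in
lemma zpd_eval {r s : ℕ} (hr : r < p) (hs : s < p) {P : MvPolynomial ZI K} (hP : P ∈ QQ K r s)
    (x y : K → Fin 3 → K) (d1 d2 : ℕ) (hx : ∀ i, ZPd d1 (fun t => x t i))
    (hy : ∀ i, ZPd d2 (fun t => y t i)) :
    ZPd (r * d1 + s * d2) (fun t => eval (Sum.elim (x t) (y t)) P) := by
  choose qx hqx hqx' using hx
  choose qy hqy hqy' using hy
  rw [QQ_span p hr hs] at hP
  induction hP using Submodule.span_induction with
  | mem P hP =>
    obtain ⟨z, rfl⟩ := hP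
    refine ⟨(∑ i, Polynomial.C (algebraMap (ZMod p) K (z.1 i)) * qx i) ^ r *
      (∑ i, Polynomial.C (algebraMap (ZMod p) K (z.2 i)) * qy i) ^ s, ?_, ?_⟩
    · refine le_trans Polynomial.natDegree_mul_le (add_le_add ?_ ?_)
      · refine le_trans Polynomial.natDegree_pow_le (Nat.mul_le_mul_left _ ?_)
        exact Polynomial.natDegree_sum_le_of_forall_le _ _
          fun i _ => (Polynomial.natDegree_C_mul_le _ _).trans (hqx i)
      · refine le_trans Polynomial.natDegree_pow_le (Nat.mul_le_mul_left _ ?_)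
        exact Polynomial.natDegree_sum_le_of_forall_le _ _
          fun i _ => (Polynomial.natDegree_C_mul_le _ _).trans (hqy i)
    · intro t
      simp only [PP_eval]
      simp [Polynomial.eval_finsetSum, hqx', hqy']
  | zero => exact ⟨0, by simp, by simp⟩
  | add P P' _ _ h1 h2 =>
    obtain ⟨q1, hq1, hq1'⟩ := h1
    obtain ⟨q2, hq2, hq2'⟩ := h2
    refine ⟨q1 + q2, (Polynomial.natDegree_add_le _ _).trans (max_le hq1 hq2), fun t => ?_⟩
    simp only [Polynomial.eval_add, hq1', hq2', map_add]
  | smul c P _ h1 =>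
    obtain ⟨q1, hq1, hq1'⟩ := h1
    refine ⟨Polynomial.C c * q1, (Polynomial.natDegree_C_mul_le _ _).trans hq1, fun t => ?_⟩
    simp only [Polynomial.eval_mul, hq1', Polynomial.eval_C, smul_eval]

open MvPolynomial in
lemma zact {r s : ℕ} (hr : r < p) (hs : s < p) {P : MvPolynomial ZI K} (hP : P ∈ QQ K r s)
    (A A' : Matrix (Fin 3) (Fin 3) K) : ∃ P' ∈ QQ K r s, ∀ x y : Fin 3 → K,
      eval (Sum.elim x y) P' = eval (Sum.elim (x ᵥ* A) (y ᵥ* A')) P := by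
  rw [QQ_span p hr hs] at hP
  induction hP using Submodule.span_induction with
  | mem P hP =>
    obtain ⟨z, rfl⟩ := hP
    refine ⟨PP (A *ᵥ fun i => algebraMap (ZMod p) K (z.1 i))
      (A' *ᵥ fun i => algebraMap (ZMod p) K (z.2 i)) r s, PP_mem _ _ _ _, fun x y => ?_⟩
    simp only [PP_eval, Fin.sum_univ_three, mulVec, vecMul, dotProduct]
    congr 2 <;> ring
  | zero => exact ⟨0, zero_mem _, by simp⟩
  | add P P' _ _ h1 h2 =>
    obtain ⟨q1, hq1, hq1'⟩ := h1
    obtain ⟨q2, hq2, hq2'⟩ := h2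
    refine ⟨q1 + q2, add_mem hq1 hq2, fun x y => ?_⟩
    rw [map_add, hq1', hq2', map_add]
  | smul c P _ h1 =>
    obtain ⟨q1, hq1, hq1'⟩ := h1
    refine ⟨c • q1, Submodule.smul_mem _ _ hq1, fun x y => ?_⟩
    rw [smul_eval, hq1', smul_eval]

open MvPolynomial in
lemma zscale {r s : ℕ} (hr : r < p) (hs : s < p) {P : MvPolynomial ZI K} (hP : P ∈ QQ K r s)
    (a b : K) (x y : Fin 3 → K) :
    eval (Sum.elim (a • x) (b • y)) P = a ^ r * b ^ s * eval (Sum.elim x y) P := by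
  rw [QQ_span p hr hs] at hP
  induction hP using Submodule.span_induction with
  | mem P hP =>
    obtain ⟨z, rfl⟩ := hP
    simp only [PP_eval, Pi.smul_apply, smul_eq_mul]
    have h1 : ∀ η x : Fin 3 → K, ∀ a : K, ∑ i, η i * (a * x i) = a * ∑ i, η i * x i := by
      intro η x a; rw [Finset.mul_sum]; exact Finset.sum_congr rfl fun i _ => by ring
    rw [h1, h1, mul_pow, mul_pow]; ring
  | zero => simp
  | add P P' _ _ h1 h2 => rw [map_add, h1, h2, map_add]; ring
  | smul c P _ h1 => rw [smul_eval, h1, smul_eval]; ring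
end PolyC

section PolyD
variable {K : Type*} [Field K] [Algebra (ZMod p) K]

def zX (u v : K) : Fin 3 → K := ![1, u, v]
def zY (u v w : K) : Fin 3 → K := ![-(v + u * w), w, 1]

lemma zpd_const (c : K) (n : ℕ) : ZPd n (fun _ : K => c) := ⟨Polynomial.C c, by simp, by simp⟩
lemma zpd_lin (a b : K) : ZPd 1 (fun t : K => a * t + b) :=
  ⟨Polynomial.C a * Polynomial.X + Polynomial.C b, Polynomial.natDegree_linear_le, by simp⟩

open MvPolynomial in
lemma zN [IsAlgClosed K] {r s : ℕ} (hr : r < p) (hs : s < p) {P : MvPolynomial ZI K} (hP : P ∈ QQ K r s)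
    (h : ∀ u v w : ZMod p, eval (Sum.elim (zX (algebraMap _ K u) (algebraMap _ K v))
      (zY (algebraMap _ K u) (algebraMap _ K v) (algebraMap _ K w))) P = 0) (u v w : K) :
    eval (Sum.elim (zX u v) (zY u v w)) P = 0 := by
  classical
  haveI : CharP K p := zcharK p
  have hp2 := (Fact.out : p.Prime).two_le
  haveI : Infinite K := IsAlgClosed.instInfinite
  let N : Submodule K (K × K × K → K) :=
    { carrier := {φ | (∃ P ∈ QQ K r s, ∀ u v w, φ (u, v, w) = eval (Sum.elim (zX u v) (zY u v w)) P) ∧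
        ∀ u v w : ZMod p, φ (algebraMap _ K u, algebraMap _ K v, algebraMap _ K w) = 0}
      add_mem' := by
        rintro f g ⟨⟨P, hP, hf⟩, hf0⟩ ⟨⟨Q, hQ, hg⟩, hg0⟩
        exact ⟨⟨P + Q, add_mem hP hQ, fun u v w => by simp [hf, hg]⟩, fun u v w => by simp [hf0, hg0]⟩
      zero_mem' := ⟨⟨0, zero_mem _, by simp⟩, by simp⟩
      smul_mem' := by
        rintro c f ⟨⟨P, hP, hf⟩, hf0⟩
        exact ⟨⟨c • P, Submodule.smul_mem _ _ hP, fun u v w => by simp [hf, smul_eval]⟩,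
          fun u v w => by simp [hf0]⟩ }
  by_contra hne
  have hN : N ≠ ⊥ := by
    rw [Submodule.ne_bot_iff]
    refine ⟨fun t => eval (Sum.elim (zX t.1 t.2.1) (zY t.1 t.2.1 t.2.2)) P,
      ⟨⟨P, hP, fun u v w => rfl⟩, h⟩, fun h0 => hne (congrFun h0 (u, v, w))⟩
  let a : Module.End K (K × K × K → K) := LinearMap.funLeft K K (fun t => (t.1 + 1, t.2.1, t.2.2))
  let c : Module.End K (K × K × K → K) := LinearMap.funLeft K K (fun t => (t.1, t.2.1 + 1, t.2.2))
  let b : Module.End K (K × K × K → K) :=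
    LinearMap.funLeft K K (fun t => (t.1, t.2.1 + t.1, t.2.2 - 1))
  have ea : ∀ φ u v w, a φ (u, v, w) = φ (u + 1, v, w) := fun _ _ _ _ => rfl
  have ec : ∀ φ u v w, c φ (u, v, w) = φ (u, v + 1, w) := fun _ _ _ _ => rfl
  have eb : ∀ φ u v w, b φ (u, v, w) = φ (u, v + u, w - 1) := fun _ _ _ _ => rfl
  have pa : ∀ n : ℕ, ∀ φ u v w, (a ^ n) φ (u, v, w) = φ (u + n, v, w) := by
    intro n
    induction n with
    | zero => intro φ u v w; simp
    | succ n ih =>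
      intro φ u v w
      rw [pow_succ', Module.End.mul_apply, ea, ih]; push_cast; congr 2; ring
  have pc : ∀ n : ℕ, ∀ φ u v w, (c ^ n) φ (u, v, w) = φ (u, v + n, w) := by
    intro n
    induction n with
    | zero => intro φ u v w; simp
    | succ n ih =>
      intro φ u v w
      rw [pow_succ', Module.End.mul_apply, ec, ih]; push_cast; congr 3; ring
  have pb : ∀ n : ℕ, ∀ φ u v w, (b ^ n) φ (u, v, w) = φ (u, v + n * u, w - n) := by
    intro n
    induction n with
    | zero => intro φ u v w; simp
    | succ n ih =>
      intro φ u v w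
      rw [pow_succ', Module.End.mul_apply, eb, ih]; push_cast; congr 3 <;> ring
  have stab : ∀ (A A' : Matrix (Fin 3) (Fin 3) K) (σ : K × K × K → K × K × K)
      (σ0 : ZMod p × ZMod p × ZMod p → ZMod p × ZMod p × ZMod p),
      (∀ u v w, zX u v ᵥ* A = zX (σ (u, v, w)).1 (σ (u, v, w)).2.1) →
      (∀ u v w, zY u v w ᵥ* A' = zY (σ (u, v, w)).1 (σ (u, v, w)).2.1 (σ (u, v, w)).2.2) →
      (∀ u v w, σ (algebraMap _ K u, algebraMap _ K v, algebraMap _ K w) =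
        (algebraMap _ K (σ0 (u, v, w)).1, algebraMap _ K (σ0 (u, v, w)).2.1,
          algebraMap _ K (σ0 (u, v, w)).2.2)) →
      ∀ φ ∈ N, LinearMap.funLeft K K σ φ ∈ N := by
    rintro A A' σ σ0 h1 h2 h3 φ ⟨⟨P, hP, hf⟩, hf0⟩
    obtain ⟨P', hP', hPP⟩ := zact p hr hs hP A A'
    refine ⟨⟨P', hP', fun u v w => ?_⟩, fun u v w => ?_⟩
    · rw [hPP, h1 u v w, h2]
      exact hf _ _ _
    · show φ (σ _) = 0
      rw [h3]; exact hf0 _ _ _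
  obtain ⟨g, ⟨⟨Q, hQ, hg⟩, hg0⟩, hgne, ga, gb, gc⟩ := zfix3 p a b c
    (by ext φ ⟨u, v, w⟩; rw [pa]; simp) (by ext φ ⟨u, v, w⟩; rw [pb]; simp)
    (by ext φ ⟨u, v, w⟩; rw [pc]; simp)
    (by intro φ; ext ⟨u, v, w⟩; rfl)
    (by intro φ; ext ⟨u, v, w⟩; simp only [eb, ec]; congr 3; ring)
    (by
      intro φ hφ
      ext ⟨u, v, w⟩
      simp only [eb, ea]
      have := congrFun hφ (u + 1, v + u, w - 1)
      rw [ec] at this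
      rw [← this]; congr 3; ring) N hN
    (stab !![1,1,0;0,1,0;0,0,1] !![1,0,0;-1,1,0;0,0,1] _ (fun t => (t.1 + 1, t.2.1, t.2.2))
      (by intro u v w; ext i; fin_cases i <;> simp [zX, vecMul, dotProduct, Fin.sum_univ_three] <;> ring)
      (by intro u v w; ext i; fin_cases i <;> simp [zY, vecMul, dotProduct, Fin.sum_univ_three] <;> ring)
      (by intro u v w; simp))
    (stab !![1,0,0;0,1,1;0,0,1] !![1,0,0;0,1,0;0,-1,1] _ (fun t => (t.1, t.2.1 + t.1, t.2.2 - 1))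
      (by intro u v w; ext i; fin_cases i <;> simp [zX, vecMul, dotProduct, Fin.sum_univ_three] <;> ring)
      (by intro u v w; ext i; fin_cases i <;> simp [zY, vecMul, dotProduct, Fin.sum_univ_three] <;> ring)
      (by intro u v w; simp))
    (stab !![1,0,1;0,1,0;0,0,1] !![1,0,0;0,1,0;-1,0,1] _ (fun t => (t.1, t.2.1 + 1, t.2.2))
      (by intro u v w; ext i; fin_cases i <;> simp [zX, vecMul, dotProduct, Fin.sum_univ_three] <;> ring)
      (by intro u v w; ext i; fin_cases i <;> simp [zY, vecMul, dotProduct, Fin.sum_univ_three] <;> ring)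
      (by intro u v w; simp))
  have ga' : ∀ u v w, g (u + 1, v, w) = g (u, v, w) := fun u v w => congrFun ga (u, v, w)
  have gb' : ∀ u v w, g (u, v + u, w - 1) = g (u, v, w) := fun u v w => congrFun gb (u, v, w)
  have gc' : ∀ u v w, g (u, v + 1, w) = g (u, v, w) := fun u v w => congrFun gc (u, v, w)
  have dv : ∀ u w, ZPd (r + s) (fun v => g (u, v, w)) := by
    intro u w
    have := zpd_eval p hr hs hQ (fun t => zX u t) (fun t => zY u t w) 1 1
      (by intro i; fin_cases i
          · exact zpd_const 1 1
          · exact zpd_const u 1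
          · simpa [zX] using zpd_lin (1 : K) 0)
      (by intro i; fin_cases i
          · simpa [zY, sub_eq_add_neg, add_comm] using zpd_lin (-1 : K) (-(u * w))
          · exact zpd_const w 1
          · exact zpd_const 1 1)
    simpa [hg] using this
  have dw : ∀ u v, ZPd s (fun w => g (u, v, w)) := by
    intro u v
    have := zpd_eval p hr hs hQ (fun t => zX u v) (fun t => zY u v t) 0 1
      (by intro i; exact zpd_const _ 0)
      (by intro i; fin_cases i
          · simpa [zY, sub_eq_add_neg, add_comm] using zpd_lin (-u : K) (-v)
          · simpa [zY] using zpd_lin (1 : K) 0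
          · exact zpd_const 1 1)
    simpa [hg] using this
  have du : ∀ v' w, ZPd r (fun u => g (u, -(v' + u * w), w)) := by
    intro v w
    have := zpd_eval p hr hs hQ (fun t => zX t (-(v + t * w))) (fun t => zY t (-(v + t * w)) w) 1 0
      (by intro i; fin_cases i
          · exact zpd_const 1 1
          · simpa [zX] using zpd_lin (1 : K) 0
          · simpa [zX, mul_comm, sub_eq_add_neg, add_comm] using zpd_lin (-w : K) (-v))
      (by intro i; fin_cases i
          · simpa [zY] using zpd_const v 0
          · exact zpd_const w 0
          · exact zpd_const 1 0)
    simpa [hg] using this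
  obtain ⟨vs, hvs⟩ : ∃ vs : K, vs ^ p - vs = 1 := by
    obtain ⟨z, hz⟩ := IsAlgClosed.exists_root (Polynomial.X ^ p - Polynomial.X - 1 : Polynomial K) (by
      have : (Polynomial.X ^ p - Polynomial.X - 1 : Polynomial K)
          = Polynomial.X ^ p - (Polynomial.X + Polynomial.C 1) := by simp [sub_sub]
      rw [this, Polynomial.degree_sub_eq_left_of_degree_lt] <;> rw [Polynomial.degree_X_pow]
      · exact_mod_cast (by omega : p ≠ 0)
      · rw [Polynomial.degree_X_add_C]; exact_mod_cast (by omega : 1 < p))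
    refine ⟨z, ?_⟩
    simp [Polynomial.IsRoot] at hz
    linear_combination hz
  have g1 : ∀ u v w, g (u, v, w) = g (u, 0, w) + (g (u, vs, w) - g (u, 0, w)) * (v ^ p - v) := by
    intro u v w
    obtain ⟨q, hqd, hq⟩ := dv u w
    obtain ⟨A, B, hAB⟩ := zper2 p q (by omega) (fun t => by simp only [hq, gc'])
    simp only [hq] at hAB
    have h0 := hAB 0
    have h1 := hAB vs
    rw [hvs] at h1
    rw [zero_pow (by omega)] at h0
    rw [hAB v, h0, h1]; ring
  have gG1 : ∀ u w, g (u, vs, w) - g (u, 0, w) = g (u, vs, 0) - g (u, 0, 0) := by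
    intro u
    obtain ⟨q1, hq1d, hq1⟩ := dw u vs
    obtain ⟨q2, hq2d, hq2⟩ := dw u 0
    intro w
    have := zper p (q1 - q2) (lt_of_le_of_lt (Polynomial.natDegree_sub_le _ _)
      (max_lt (by omega) (by omega))) (fun t => by
        simp only [Polynomial.eval_sub, hq1, hq2]
        have e1 := gb' u vs (t + 1)
        have e2 := gb' u 0 (t + 1)
        rw [add_sub_cancel_right, g1] at e1 e2
        rw [add_pow_char] at e1 e2
        rw [zero_pow (by omega)] at e2
        linear_combination e2 - e1 + (g (u, vs, t) - g (u, 0, t)) * hvs) w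
    simpa [hq1, hq2] using this
  have gG0 : ∀ u w, g (u, 0, w) = g (u, 0, 0) + w * ((g (u, vs, 0) - g (u, 0, 0)) * (u ^ p - u)) := by
    intro u
    obtain ⟨q2, hq2d, hq2⟩ := dw u 0
    intro w
    have := zper p (q2 - Polynomial.C ((g (u, vs, 0) - g (u, 0, 0)) * (u ^ p - u)) * Polynomial.X)
      (lt_of_le_of_lt (Polynomial.natDegree_sub_le _ _)
      (max_lt (by omega) (lt_of_le_of_lt ((Polynomial.natDegree_C_mul_le _ _).trans Polynomial.natDegree_X_le) (by omega)))) (fun t => by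
        simp only [Polynomial.eval_sub, hq2, Polynomial.eval_mul, Polynomial.eval_C, Polynomial.eval_X]
        have e2 := gb' u 0 (t + 1)
        rw [add_sub_cancel_right, g1, gG1, zero_add] at e2
        linear_combination -e2) w
    simp only [Polynomial.eval_sub, hq2, Polynomial.eval_mul, Polynomial.eval_C, Polynomial.eval_X] at this
    linear_combination this
  have gh : ∀ u, g (u, 0, 0) = 0 := by
    obtain ⟨q, hqd, hq⟩ := du 0 0
    intro u
    have := zper p q (by omega) (fun t => by simp only [hq]; simpa using ga' t 0 0) u
    simp only [hq] at this
    have h00 := hg0 0 0 0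
    simp at this h00
    rw [this, h00]
  have gH : ∀ u v w, g (u, v, w) = g (u, vs, 0) * (w * (u ^ p - u) + v ^ p - v) := by
    intro u v w
    rw [g1, gG1, gG0, gh]; ring
  have neg_p : ∀ x : K, (-x) ^ p = - x ^ p := by
    intro x
    have := sub_pow_char (R := K) (p := p) (x := 0) (y := x)
    simpa [zero_pow (show p ≠ 0 by omega)] using this
  obtain ⟨q1, hq1d, hq1⟩ := du vs 0
  obtain ⟨q2, hq2d, hq2⟩ := du 0 vs
  have e1 : ∀ u, q1.eval u = - g (u, vs, 0) := by
    intro u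
    rw [hq1]
    simp only
    rw [gH, neg_p]
    simp only [mul_zero, add_zero, zero_mul]
    linear_combination (-g (u, vs, 0)) * hvs
  have e2 : Polynomial.X ^ p * q1 = q2 := by
    apply Polynomial.funext
    intro u
    rw [hq2, Polynomial.eval_mul, e1]
    simp only
    rw [gH u (-(0 + u * vs)), neg_p, zero_add, mul_pow]
    simp only [Polynomial.eval_pow, Polynomial.eval_X]
    linear_combination (g (u, vs, 0) * u ^ p) * hvs
  have hq10 : q1 = 0 := by
    by_contra h
    rw [← e2, mul_comm, Polynomial.natDegree_mul_X_pow _ h] at hq2d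
    omega
  apply hgne
  ext ⟨u, v, w⟩
  have := e1 u
  rw [hq10, Polynomial.eval_zero] at this
  rw [gH, neg_eq_zero.mp this.symm]; simp

open MvPolynomial in
lemma zN_dvd [IsAlgClosed K] {r s : ℕ} (hr : r < p) (hs : s < p) {P : MvPolynomial ZI K}
    (hP : P ∈ QQ K r s)
    (h : ∀ u v w : ZMod p, eval (Sum.elim (zX (algebraMap _ K u) (algebraMap _ K v))
      (zY (algebraMap _ K u) (algebraMap _ K v) (algebraMap _ K w))) P = 0) : zf K ∣ P := by
  apply zf_null
  intro x y hx hy hxy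
  have e1 : x = x 0 • zX (x 1 / x 0) (x 2 / x 0) := by
    ext i; fin_cases i <;> simp [zX] <;> field_simp
  have e2 : y = y 2 • zY (x 1 / x 0) (x 2 / x 0) (y 1 / y 2) := by
    ext i; fin_cases i
    · simp [zY]
      rw [Fin.sum_univ_three] at hxy
      field_simp
      linear_combination hxy
    · simp [zY]; field_simp
    · simp [zY]
  rw [e1, e2, zscale p hr hs hP, zN p hr hs hP h, mul_zero]
end PolyD

section EvA

noncomputable abbrev zal (z : ZMod p) : kbar p := algebraMap (ZMod p) (kbar p) z
def zx (g : Gp p) : Fin 3 → ZMod p := (g : Matrix (Fin 3) (Fin 3) (ZMod p)) 2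
def zyM (M : Matrix (Fin 3) (Fin 3) (ZMod p)) : Fin 3 → ZMod p :=
  ![M 2 1 * M 1 2 - M 2 2 * M 1 1, M 2 2 * M 1 0 - M 2 0 * M 1 2, M 2 0 * M 1 1 - M 2 1 * M 1 0]
def zy (g : Gp p) : Fin 3 → ZMod p := zyM p (g : Matrix (Fin 3) (Fin 3) (ZMod p))
abbrev zdet (g : Gp p) : ZMod p := det (g : Matrix (Fin 3) (Fin 3) (ZMod p))

noncomputable def PZ (η ξ : Fin 3 → ZMod p) (r s : ℕ) : MvPolynomial ZI (kbar p) :=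
  PP (fun i => zal p (η i)) (fun i => zal p (ξ i)) r s

open MvPolynomial in
noncomputable def zEv (t : ℕ) : MvPolynomial ZI (kbar p) →ₗ[kbar p] (Gp p → kbar p) where
  toFun P := fun g => zal p (zdet p g) ^ t *
    eval (Sum.elim (fun i => zal p (zx p g i)) (fun i => zal p (zy p g i))) P
  map_add' P Q := by ext g; simp [mul_add]
  map_smul' c P := by ext g; simp [smul_eval]; ring

open MvPolynomial in
lemma zEv_apply (t : ℕ) (P : MvPolynomial ZI (kbar p)) (g : Gp p) : zEv p t P g = zal p (zdet p g) ^ t *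
    eval (Sum.elim (fun i => zal p (zx p g i)) (fun i => zal p (zy p g i))) P := rfl

lemma zEv_PZ (t : ℕ) (η ξ : Fin 3 → ZMod p) (r s : ℕ) (g : Gp p) :
    zEv p t (PZ p η ξ r s) g =
      zal p (zdet p g ^ t * ((η ⬝ᵥ zx p g) ^ r * (ξ ⬝ᵥ zy p g) ^ s)) := by
  rw [zEv_apply, PZ, PP_eval]; simp [zal, dotProduct]

lemma zxy (g : Gp p) : ∑ i, zx p g i * zy p g i = 0 := by
  simp [Fin.sum_univ_three, zx, zy, zyM]; ring

lemma zEv_zf (t : ℕ) (P : MvPolynomial ZI (kbar p)) (h : zf (kbar p) ∣ P) : zEv p t P = 0 := by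
  obtain ⟨R, rfl⟩ := h
  ext g
  rw [zEv_apply, map_mul, zf_eval]
  have := congrArg (zal p) (zxy p g)
  simp only [zal, map_sum, map_mul, map_zero] at this
  rw [this]; simp

lemma zdet_ne (g : Gp p) : zdet p g ≠ 0 := GeneralLinearGroup.det_ne_zero g
lemma zal_ne {z : ZMod p} (h : z ≠ 0) : zal p z ≠ 0 := by simpa [zal] using h

lemma zEv_ind {r s : ℕ} (hr : r < p) (hs : s < p) (t : ℕ) {P : MvPolynomial ZI (kbar p)}
    (hP : P ∈ QQ (kbar p) r s) : zEv p t P ∈ IndS p t (t + s) (t + s + r) := by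
  change zEv p t P ∈ IndSet p _ _ _
  intro B g h1 h2 h3
  set M := (B : Matrix (Fin 3) (Fin 3) (ZMod p)) with hM
  have e1 : (fun i => zal p (zx p (B * g) i)) = zal p (M 2 2) • (fun i => zal p (zx p g i)) := by
    ext i
    simp [zx, mul_apply, Fin.sum_univ_three, ← hM, h2, h3]
  have e2 : (fun i => zal p (zy p (B * g) i)) =
      zal p (M 2 2 * M 1 1) • (fun i => zal p (zy p g i)) := by
    ext i
    have : zy p (B * g) i = M 2 2 * M 1 1 * zy p g i := by
      fin_cases i <;> simp [zy, zyM, mul_apply, Fin.sum_univ_three, ← hM, h1, h2, h3] <;> ring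
    simp [this]
  have e3 : zdet p (B * g) = M 0 0 * M 1 1 * M 2 2 * zdet p g := by
    rw [zdet, Units.val_mul, det_mul, ← hM, det_fin_three M, h1, h2, h3]; simp
  rw [zEv_apply, zEv_apply, e1, e2, zscale p hr hs hP, e3]
  simp only [zal, map_mul]; ring

def zcof (k : Gp p) : Matrix (Fin 3) (Fin 3) (ZMod p) :=
  (adjugate (k : Matrix (Fin 3) (Fin 3) (ZMod p)))ᵀ

lemma zEv_rT (k : Gp p) (t : ℕ) (η ξ : Fin 3 → ZMod p) (r s : ℕ) :
    rT p k (zEv p t (PZ p η ξ r s)) = zal p (zdet p k ^ t) •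
      zEv p t (PZ p ((k : Matrix (Fin 3) (Fin 3) (ZMod p)) *ᵥ η) (zcof p k *ᵥ ξ) r s) := by
  ext g
  show zEv p t _ (g * k) = _
  rw [Pi.smul_apply, smul_eq_mul, zEv_PZ, zEv_PZ, ← map_mul]
  congr 1
  have e1 : η ⬝ᵥ zx p (g * k) = ((k : Matrix (Fin 3) (Fin 3) (ZMod p)) *ᵥ η) ⬝ᵥ zx p g := by
    simp [zx, dotProduct, mulVec, mul_apply, Fin.sum_univ_three]; ring
  have e2 : ξ ⬝ᵥ zy p (g * k) = (zcof p k *ᵥ ξ) ⬝ᵥ zy p g := by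
    simp [zy, zyM, zcof, adjugate_fin_three, dotProduct, mulVec, mul_apply, Fin.sum_univ_three]; ring
  rw [e1, e2, zdet, Units.val_mul, det_mul]; ring

lemma zcof_dot (k : Gp p) (η ξ : Fin 3 → ZMod p) :
    ((k : Matrix (Fin 3) (Fin 3) (ZMod p)) *ᵥ η) ⬝ᵥ (zcof p k *ᵥ ξ) = zdet p k * (η ⬝ᵥ ξ) := by
  simp [zcof, adjugate_fin_three, zdet, det_fin_three, dotProduct, mulVec, Fin.sum_univ_three]; ring

lemma zmul_tr (h k : Gp p) : ∃ h' : Gp p, zx p h' = (k : Matrix (Fin 3) (Fin 3) (ZMod p)) *ᵥ zx p h ∧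
    zy p h' = zcof p k *ᵥ zy p h := by
  have hd : det ((h : Matrix (Fin 3) (Fin 3) (ZMod p)) * (k : Matrix (Fin 3) (Fin 3) (ZMod p))ᵀ) ≠ 0 := by
    rw [det_mul, det_transpose]
    exact mul_ne_zero (zdet_ne p h) (zdet_ne p k)
  refine ⟨GeneralLinearGroup.mkOfDetNeZero _ hd, ?_, ?_⟩
  · ext i
    rw [zx, zmk_coe]
    simp [zx, mulVec, dotProduct, mul_apply, Fin.sum_univ_three]; ring
  · rw [zy, zmk_coe]
    ext i
    fin_cases i <;> simp [zy, zyM, zcof, adjugate_fin_three, dotProduct, mulVec, mul_apply, Fin.sum_univ_three] <;> ring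

def zu (u v w : ZMod p) : Gp p :=
  GeneralLinearGroup.mkOfDetNeZero !![1,u,v;0,1,w;0,0,1] (by simp [det_fin_three])
def zbc (u v w : ZMod p) : Gp p :=
  GeneralLinearGroup.mkOfDetNeZero !![0,0,1;0,1,-w;1,u,v] (by simp [det_fin_three])

lemma zbc_x (u v w : ZMod p) : zx p (zbc p u v w) = ![1, u, v] := by
  ext i; rw [zx, zbc, zmk_coe]; fin_cases i <;> simp
lemma zbc_y (u v w : ZMod p) : zy p (zbc p u v w) = ![-(v + u * w), w, 1] := by
  rw [zy, zbc, zmk_coe]; ext i; fin_cases i <;> simp [zyM]; ring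
lemma zbc_det (u v w : ZMod p) : zdet p (zbc p u v w) = -1 := by
  rw [zdet, zbc, zmk_coe, det_fin_three]; simp

lemma zu_mul (u v w u' v' w' : ZMod p) :
    zu p u v w * zu p u' v' w' = zu p (u + u') (v + v' + u * w') (w + w') := by
  ext i j
  simp only [zu, Units.val_mul, zmk_coe]
  fin_cases i <;> fin_cases j <;> simp [mul_apply, Fin.sum_univ_three] <;> ring

lemma zbc_mul (u v w u' v' w' : ZMod p) :
    zbc p u v w * zu p u' v' w' = zbc p (u + u') (v + v' + u * w') (w - w') := by
  ext i j
  simp only [zu, zbc, Units.val_mul, zmk_coe]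
  fin_cases i <;> fin_cases j <;> simp [mul_apply, Fin.sum_univ_three] <;> ring

lemma zu_zero : zu p 0 0 0 = 1 := by
  ext i j
  simp only [zu, zmk_coe]
  fin_cases i <;> fin_cases j <;> simp

lemma rT_mul (g h : Gp p) (φ : Gp p → kbar p) : rT p g (rT p h φ) = rT p (g * h) φ := by
  ext x; show φ _ = φ _; rw [mul_assoc]

lemma rT_one (φ : Gp p → kbar p) : rT p 1 φ = φ := by
  ext x; show φ _ = φ _; rw [mul_one]

lemma rT_pow (g : Gp p) (n : ℕ) (φ : Gp p → kbar p) :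
    ((rT p g : Module.End (kbar p) (Gp p → kbar p)) ^ n) φ = rT p (g ^ n) φ := by
  induction n with
  | zero => simp [rT_one]
  | succ n ih => rw [pow_succ', Module.End.mul_apply, ih, rT_mul, pow_succ']

lemma zu_pow1 (n : ℕ) : zu p 1 0 0 ^ n = zu p n 0 0 := by
  induction n with
  | zero => simp [zu_zero]
  | succ n ih => rw [pow_succ, ih, zu_mul]; simp
lemma zu_pow2 (n : ℕ) : zu p 0 1 0 ^ n = zu p 0 n 0 := by
  induction n with
  | zero => simp [zu_zero]
  | succ n ih => rw [pow_succ, ih, zu_mul]; simp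
lemma zu_pow3 (n : ℕ) : zu p 0 0 1 ^ n = zu p 0 0 n := by
  induction n with
  | zero => simp [zu_zero]
  | succ n ih => rw [pow_succ, ih, zu_mul]; simp

def ZUf (φ : Gp p → kbar p) : Prop :=
  rT p (zu p 1 0 0) φ = φ ∧ rT p (zu p 0 0 1) φ = φ ∧ rT p (zu p 0 1 0) φ = φ

lemma zUfix (N : Submodule (kbar p) (Gp p → kbar p)) (hN : N ≠ ⊥) (hs : ZStab (rT p) N) :
    ∃ φ ∈ N, φ ≠ 0 ∧ ZUf p φ := by
  have := zfix3 p (V := Gp p → kbar p) (rT p (zu p 1 0 0)) (rT p (zu p 0 0 1)) (rT p (zu p 0 1 0))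
    (by refine LinearMap.ext fun φ => ?_; rw [rT_pow, zu_pow1]; simp [zu_zero, rT_one])
    (by refine LinearMap.ext fun φ => ?_; rw [rT_pow, zu_pow3]; simp [zu_zero, rT_one])
    (by refine LinearMap.ext fun φ => ?_; rw [rT_pow, zu_pow2]; simp [zu_zero, rT_one])
    (by intro φ; simp [rT_mul, zu_mul])
    (by intro φ; simp [rT_mul, zu_mul])
    (by
      intro φ h
      rw [rT_mul, rT_mul]
      nth_rewrite 2 [← h]
      rw [rT_mul]; simp [zu_mul]) N hN (fun v hv => hs _ v hv) (fun v hv => hs _ v hv)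
      (fun v hv => hs _ v hv)
  exact this

lemma zconst {α : Type*} (F : ZMod p → α) (h : ∀ t, F (t + 1) = F t) (t : ZMod p) : F t = F 0 := by
  have hn : ∀ n : ℕ, F (n : ZMod p) = F 0 := by
    intro n
    induction n with
    | zero => simp
    | succ n ih => rw [Nat.cast_succ, h, ih]
  simpa using hn t.val

lemma zUf_bc (φ : Gp p → kbar p) (h : ZUf p φ) (u v w : ZMod p) :
    φ (zbc p u v w) = φ (zbc p 0 0 0) := by
  obtain ⟨h1, h3, h2⟩ := h
  have a1 : ∀ u v w, φ (zbc p (u + 1) v w) = φ (zbc p u v w) := by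
    intro u v w
    have := congrFun h1 (zbc p u v w)
    change φ (zbc p u v w * _) = _ at this
    rw [zbc_mul] at this; simpa using this
  have a2 : ∀ u v w, φ (zbc p u (v + 1) w) = φ (zbc p u v w) := by
    intro u v w
    have := congrFun h2 (zbc p u v w)
    change φ (zbc p u v w * _) = _ at this
    rw [zbc_mul] at this; simpa using this
  have a2' : ∀ u v w, φ (zbc p u v w) = φ (zbc p u 0 w) := fun u v w =>
    zconst p (fun v => φ (zbc p u v w)) (fun v => a2 u v w) v
  have a3 : ∀ w, φ (zbc p 0 0 (w + 1)) = φ (zbc p 0 0 w) := by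
    intro w
    have := congrFun h3 (zbc p 0 0 (w + 1))
    change φ (zbc p 0 0 (w + 1) * _) = _ at this
    rw [zbc_mul] at this; simpa using this.symm
  rw [a2', zconst p (fun u => φ (zbc p u 0 w)) (fun u => a1 u 0 w) u]
  exact zconst p (fun w => φ (zbc p 0 0 w)) a3 w
end EvA

section EvB

noncomputable def zM (r s t : ℕ) : Submodule (kbar p) (Gp p → kbar p) := (QQ (kbar p) r s).map (zEv p t)
noncomputable def zW (r s : ℕ) : Submodule (kbar p) (MvPolynomial ZI (kbar p)) :=
  Submodule.span (kbar p) (Set.range fun h : Gp p => PZ p (zx p h) (zy p h) r s)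
noncomputable def zS (r s t : ℕ) : Submodule (kbar p) (Gp p → kbar p) := (zW p r s).map (zEv p t)
noncomputable def zk0 (r s t : ℕ) : Gp p → kbar p :=
  zEv p t (PZ p (zx p (zbc p 0 0 0)) (zy p (zbc p 0 0 0)) r s)

lemma PZ_mem (η ξ : Fin 3 → ZMod p) (r s : ℕ) : PZ p η ξ r s ∈ QQ (kbar p) r s := PP_mem _ _ _ _

lemma zW_le (r s : ℕ) : zW p r s ≤ QQ (kbar p) r s := by
  rw [zW, Submodule.span_le]; rintro _ ⟨h, rfl⟩; exact PZ_mem p _ _ _ _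

lemma zS_le (r s t : ℕ) : zS p r s t ≤ zM p r s t := Submodule.map_mono (zW_le p r s)

lemma QQ_spanZ {r s : ℕ} (hr : r < p) (hs : s < p) : QQ (kbar p) r s =
    Submodule.span (kbar p) (Set.range fun z : (Fin 3 → ZMod p) × (Fin 3 → ZMod p) =>
      PZ p z.1 z.2 r s) := QQ_span p hr hs

lemma zS_stab (r s t : ℕ) : ZStab (rT p) (zS p r s t) := by
  rintro k _ ⟨P, hP, rfl⟩
  have hP' : P ∈ zW p r s := hP
  rw [zW] at hP'
  induction hP' using Submodule.span_induction with
  | mem P h =>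
    obtain ⟨h, rfl⟩ := h
    simp only
    rw [zEv_rT]
    obtain ⟨h', e1, e2⟩ := zmul_tr p h k
    rw [← e1, ← e2]
    exact Submodule.smul_mem _ _ ⟨_, Submodule.subset_span ⟨h', rfl⟩, rfl⟩
  | zero => simp
  | add P Q h1 h2 i1 i2 => rw [map_add, map_add]; exact add_mem (i1 h1) (i2 h2)
  | smul c P h1 i1 => rw [map_smul, map_smul]; exact Submodule.smul_mem _ _ (i1 h1)

lemma zM_stab {r s : ℕ} (hr : r < p) (hs : s < p) (t : ℕ) : ZStab (rT p) (zM p r s t) := by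
  rintro k _ ⟨P, hP, rfl⟩
  have hP' : P ∈ QQ (kbar p) r s := hP
  rw [QQ_spanZ p hr hs] at hP'
  clear hP
  induction hP' using Submodule.span_induction with
  | mem P h =>
    obtain ⟨h, rfl⟩ := h
    simp only
    rw [zEv_rT]
    exact Submodule.smul_mem _ _ ⟨_, PZ_mem p _ _ _ _, rfl⟩
  | zero => simp
  | add P Q h1 h2 i1 i2 => rw [map_add, map_add]; exact add_mem i1 i2
  | smul c P h1 i1 => rw [map_smul, map_smul]; exact Submodule.smul_mem _ _ i1

lemma zk0_bc (r s t : ℕ) (u v w : ZMod p) : zk0 p r s t (zbc p u v w) = (-1) ^ t := by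
  rw [zk0, zEv_PZ, zbc_x, zbc_y, zbc_x, zbc_y, zbc_det]
  simp [dotProduct, Fin.sum_univ_three]

lemma zk0_ne (r s t : ℕ) : zk0 p r s t ≠ 0 := by
  intro h
  have := zk0_bc p r s t 0 0 0
  rw [h] at this
  have h2 : ((-1 : kbar p) ^ t) ≠ 0 := pow_ne_zero _ (by simp)
  exact h2 this.symm

lemma zk0_mem (r s t : ℕ) : zk0 p r s t ∈ zS p r s t :=
  ⟨_, Submodule.subset_span ⟨zbc p 0 0 0, rfl⟩, rfl⟩

open MvPolynomial in
lemma zEv_dvd {r s : ℕ} (hr : r < p) (hs : s < p) {t : ℕ} {P : MvPolynomial ZI (kbar p)}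
    (hP : P ∈ QQ (kbar p) r s) (h : ∀ u v w, zEv p t P (zbc p u v w) = 0) : zf (kbar p) ∣ P := by
  apply zN_dvd p hr hs hP
  intro u v w
  have := h u v w
  rw [zEv_apply, zbc_det, zbc_x, zbc_y] at this
  have h2 := (mul_eq_zero.mp this).resolve_left (pow_ne_zero _ (by simp))
  convert h2 using 4
  · ext i; fin_cases i <;> simp [zX]
  · ext i; fin_cases i <;> simp [zY]

lemma zUf_M {r s : ℕ} (hr : r < p) (hs : s < p) {t : ℕ} {φ : Gp p → kbar p} (hφ : φ ∈ zM p r s t)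
    (h : ZUf p φ) : ∃ c : kbar p, φ = c • zk0 p r s t := by
  obtain ⟨P, hP, rfl⟩ := hφ
  have hP : P ∈ QQ (kbar p) r s := hP
  set c : kbar p := zEv p t P (zbc p 0 0 0) * ((-1) ^ t)⁻¹ with hc
  refine ⟨c, ?_⟩
  have hd : zf (kbar p) ∣ P - c • PZ p (zx p (zbc p 0 0 0)) (zy p (zbc p 0 0 0)) r s := by
    apply zEv_dvd p hr hs (t := t) (sub_mem hP (Submodule.smul_mem _ _ (PZ_mem p _ _ _ _)))
    intro u v w
    rw [map_sub, map_smul, Pi.sub_apply, Pi.smul_apply, zUf_bc p _ h]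
    have := zk0_bc p r s t u v w
    rw [zk0] at this
    rw [this, hc, smul_eq_mul, mul_assoc, inv_mul_cancel₀ (pow_ne_zero _ (by simp)), mul_one, sub_self]
  have := zEv_zf p t _ hd
  rw [map_sub, map_smul, sub_eq_zero] at this
  exact this

lemma zS_gen {r s t : ℕ} (N : Submodule (kbar p) (Gp p → kbar p)) (hN : ZStab (rT p) N)
    (h : zk0 p r s t ∈ N) : zS p r s t ≤ N := by
  rw [zS, zW, Submodule.map_span, Submodule.span_le]
  rintro _ ⟨_, ⟨h', rfl⟩, rfl⟩
  set A := (zbc p 0 0 0)⁻¹ * h' with hA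
  have hd : det ((A : Matrix (Fin 3) (Fin 3) (ZMod p))ᵀ) ≠ 0 := by
    rw [det_transpose]; exact zdet_ne p A
  set k : Gp p := GeneralLinearGroup.mkOfDetNeZero _ hd with hk
  have hkc : (k : Matrix (Fin 3) (Fin 3) (ZMod p)) = (A : Matrix (Fin 3) (Fin 3) (ZMod p))ᵀ := zmk_coe p _ hd
  have hh : (h' : Matrix (Fin 3) (Fin 3) (ZMod p)) = (zbc p 0 0 0 : Matrix (Fin 3) (Fin 3) (ZMod p)) *
      (k : Matrix (Fin 3) (Fin 3) (ZMod p))ᵀ := by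
    rw [hkc, transpose_transpose, ← Units.val_mul, hA, mul_inv_cancel_left]
  have h1 := hN k _ h
  rw [zk0, zEv_rT] at h1
  have e1 : (k : Matrix (Fin 3) (Fin 3) (ZMod p)) *ᵥ zx p (zbc p 0 0 0) = zx p h' := by
    ext i
    rw [zx, zx, hh]
    simp [mulVec, dotProduct, mul_apply, Fin.sum_univ_three]; ring
  have e2 : zcof p k *ᵥ zy p (zbc p 0 0 0) = zy p h' := by
    rw [zy, zy, hh]
    ext i
    fin_cases i <;> simp [zyM, zcof, adjugate_fin_three, dotProduct, mulVec, mul_apply, Fin.sum_univ_three] <;> ring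
  rw [e1, e2] at h1
  have h2 := N.smul_mem (zal p (zdet p k ^ t))⁻¹ h1
  rwa [smul_smul, inv_mul_cancel₀ (zal_ne p (pow_ne_zero _ (zdet_ne p k))), one_smul] at h2

lemma zS_simp {r s : ℕ} (hr : r < p) (hs : s < p) (t : ℕ) : ZSimp (rT p) (zS p r s t) := by
  refine ⟨zS_stab p r s t, ?_, ?_⟩
  · rw [Submodule.ne_bot_iff]; exact ⟨_, zk0_mem p r s t, zk0_ne p r s t⟩
  · intro Z hZ hle
    by_cases hb : Z = ⊥
    · exact Or.inl hb
    · right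
      refine le_antisymm hle (zS_gen p Z hZ ?_)
      obtain ⟨φ, hφ, hφ0, hU⟩ := zUfix p Z hb hZ
      obtain ⟨c, rfl⟩ := zUf_M p hr hs (zS_le p r s t (hle hφ)) hU
      have hc : c ≠ 0 := by rintro rfl; simp at hφ0
      have := Z.smul_mem c⁻¹ hφ
      rwa [smul_smul, inv_mul_cancel₀ hc, one_smul] at this

def zdg (d : Fin 3 → ZMod p) (h : d 0 * d 1 * d 2 ≠ 0) : Gp p :=
  GeneralLinearGroup.mkOfDetNeZero !![d 0,0,0;0,d 1,0;0,0,d 2] (by simpa [det_fin_three] using h)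

lemma zk0_T (r s t : ℕ) (d : Fin 3 → ZMod p) (h : d 0 * d 1 * d 2 ≠ 0) :
    rT p (zdg p d h) (zk0 p r s t) =
      zal p ((d 0 * d 1 * d 2) ^ t * (d 0 ^ r * (d 0 * d 1) ^ s)) • zk0 p r s t := by
  ext g
  rw [zk0, zEv_rT, Pi.smul_apply, Pi.smul_apply, smul_eq_mul, smul_eq_mul, zEv_PZ, zEv_PZ,
    ← map_mul, ← map_mul]
  congr 1
  have e1 : zdet p (zdg p d h) = d 0 * d 1 * d 2 := by
    rw [zdet, zdg, zmk_coe]; simp [det_fin_three]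
  rw [e1, zbc_x, zbc_y, zcof, zdg, zmk_coe]
  simp [adjugate_fin_three, mulVec, dotProduct, Fin.sum_univ_three]
  ring

lemma zk0_U (r s t : ℕ) : ZUf p (zk0 p r s t) := by
  have key : ∀ u v w, rT p (zu p u v w) (zk0 p r s t) = zk0 p r s t := by
    intro u v w
    have e1 : zdet p (zu p u v w) = 1 := by
      rw [zdet, zu, zmk_coe]; simp [det_fin_three]
    rw [zk0, zEv_rT, e1, one_pow, show zal p 1 = 1 from map_one _, one_smul]
    have e2 : (zu p u v w : Matrix (Fin 3) (Fin 3) (ZMod p)) *ᵥ zx p (zbc p 0 0 0) = zx p (zbc p 0 0 0) := by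
      rw [zbc_x, zu, zmk_coe]; ext i; fin_cases i <;> simp [mulVec, dotProduct, Fin.sum_univ_three]
    have e3 : zcof p (zu p u v w) *ᵥ zy p (zbc p 0 0 0) = zy p (zbc p 0 0 0) := by
      rw [zbc_y, zcof, zu, zmk_coe]; ext i
      fin_cases i <;> simp [adjugate_fin_three, mulVec, dotProduct, Fin.sum_univ_three]
    rw [e2, e3]
  exact ⟨key _ _ _, key _ _ _, key _ _ _⟩

lemma zS_iso {r s t r' s' t' : ℕ} (hr : r' < p) (hs : s' < p)
    (h : ZIso (rT p) (zS p r s t) (zS p r' s' t')) :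
    t + s + r ≡ t' + s' + r' [MOD p - 1] ∧ t + s ≡ t' + s' [MOD p - 1] ∧ t ≡ t' [MOD p - 1] := by
  obtain ⟨C, hC, hm, hi⟩ := h
  set φ := C (zk0 p r s t) with hφ
  have hmem : φ ∈ zS p r' s' t' := by rw [← hm]; exact ⟨_, zk0_mem p r s t, rfl⟩
  have hne : φ ≠ 0 := fun h => zk0_ne p r s t (hi _ (zk0_mem p r s t) h)
  have hU := zk0_U p r s t
  have hk := zk0_mem p r s t
  have hφU : ZUf p φ := ⟨by rw [hφ, ← hC _ _ hk, hU.1], by rw [hφ, ← hC _ _ hk, hU.2.1],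
    by rw [hφ, ← hC _ _ hk, hU.2.2]⟩
  obtain ⟨c, hc⟩ := zUf_M p hr hs (zS_le p _ _ _ hmem) hφU
  have key : ∀ (d : Fin 3 → ZMod p) (h : d 0 * d 1 * d 2 ≠ 0),
      (d 0 * d 1 * d 2) ^ t * (d 0 ^ r * (d 0 * d 1) ^ s) =
      (d 0 * d 1 * d 2) ^ t' * (d 0 ^ r' * (d 0 * d 1) ^ s') := by
    intro d h
    have h1 : rT p (zdg p d h) φ = zal p ((d 0 * d 1 * d 2) ^ t * (d 0 ^ r * (d 0 * d 1) ^ s)) • φ := by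
      rw [hφ, ← hC _ _ hk, zk0_T, map_smul]
    have h2 : rT p (zdg p d h) φ = zal p ((d 0 * d 1 * d 2) ^ t' * (d 0 ^ r' * (d 0 * d 1) ^ s')) • φ := by
      rw [hc, map_smul, zk0_T, smul_comm]
    rw [h1] at h2
    have h3 := smul_left_injective (kbar p) hne h2
    exact (algebraMap (ZMod p) (kbar p)).injective h3
  obtain ⟨ζ, hζ, hζe⟩ := zgen p
  have k1 := key ![ζ, 1, 1] (by simpa using hζ)
  have k2 := key ![1, ζ, 1] (by simpa using hζ)
  have k3 := key ![1, 1, ζ] (by simpa using hζ)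
  simp [← pow_add] at k1 k2 k3
  rw [hζe] at k1 k2 k3
  refine ⟨?_, k2, k3⟩
  rw [show t + s + r = t + (r + s) by ring, show t' + s' + r' = t' + (r' + s') by ring]; exact k1
end EvB

section PolyE
variable {K : Type*} [Field K]

lemma zf_pow_mem {a b : ℕ} {g : MvPolynomial ZI K} (hg : g ∈ QQ K a b) (j : ℕ) :
    zf K ^ j * g ∈ QQ K (a + j) (b + j) := by
  induction j with
  | zero => simpa using hg
  | succ j ih =>
    have := zf_mul_mem ih
    rw [pow_succ', mul_assoc]; exact this

lemma zD_fj {a b : ℕ} {g : MvPolynomial ZI K} (hg : g ∈ QQ K a b) (j : ℕ) :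
    zD K (zf K ^ (j + 1) * g) = zf K ^ (j + 1) * zD K g +
      (((j + 1) * (a + b + j + 3) : ℕ) : K) • (zf K ^ j * g) := by
  induction j with
  | zero => simp [zD_f hg]
  | succ j ih =>
    rw [pow_succ', mul_assoc, zD_f (zf_pow_mem hg (j + 1)), ih]
    simp only [Algebra.smul_def]
    push_cast
    simp only [map_add, map_mul, map_natCast, map_one, map_ofNat]
    ring

lemma zker_step {a b : ℕ} {g : MvPolynomial ZI K} (hg : g ∈ QQ K a b) (j : ℕ)
    (h : zD K (zf K ^ (j + 1) * g) = 0) (hc : (((j + 1) * (a + b + j + 3) : ℕ) : K) ≠ 0) : zf K ∣ g := by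
  rw [zD_fj hg] at h
  have h2 : zf K ^ j * (zf K * zD K g + (((j + 1) * (a + b + j + 3) : ℕ) : K) • g) = 0 := by
    rw [← h, mul_add, mul_smul_comm]; ring
  have h3 := (mul_eq_zero.mp h2).resolve_left (pow_ne_zero _ zf_ne)
  have h4 : zf K ∣ (((j + 1) * (a + b + j + 3) : ℕ) : K) • g :=
    ⟨- zD K g, by linear_combination h3⟩
  have h5 := h4.mul_left (MvPolynomial.C (((j + 1) * (a + b + j + 3) : ℕ) : K)⁻¹)
  rwa [MvPolynomial.C_mul', smul_smul, inv_mul_cancel₀ hc, one_smul] at h5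

lemma zker_A (p : ℕ) [Fact p.Prime] [CharP K p] (a : ℕ) : ∀ (b j : ℕ) (g : MvPolynomial ZI K), g ∈ QQ K a b →
    a + b + 2 * j + 4 ≤ p → zD K (zf K ^ (j + 1) * g) = 0 → g = 0 := by
  induction a with
  | zero =>
    intro b j g hg hp h
    refine zf_dvd_zero hg (zker_step hg j h ?_) (Or.inl rfl)
    rw [Ne, CharP.cast_eq_zero_iff K p, (Fact.out : p.Prime).dvd_mul, not_or]
    exact ⟨Nat.not_dvd_of_pos_of_lt (by omega) (by omega), Nat.not_dvd_of_pos_of_lt (by omega) (by omega)⟩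
  | succ a ih =>
    intro b j g hg hp h
    have hd : zf K ∣ g := by
      refine zker_step hg j h ?_
      rw [Ne, CharP.cast_eq_zero_iff K p, (Fact.out : p.Prime).dvd_mul, not_or]
      exact ⟨Nat.not_dvd_of_pos_of_lt (by omega) (by omega), Nat.not_dvd_of_pos_of_lt (by omega) (by omega)⟩
    cases b with
    | zero => exact zf_dvd_zero hg hd (Or.inr rfl)
    | succ b =>
      obtain ⟨R, hR, rfl⟩ := zf_dvd hg hd
      rw [ih b (j + 1) R hR (by omega) (by rw [pow_succ, mul_assoc]; exact h), mul_zero]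

lemma zker_A' (p : ℕ) [Fact p.Prime] [CharP K p] {r s : ℕ} (hp : r + s + 2 ≤ p) {P : MvPolynomial ZI K}
    (hP : P ∈ QQ K r s) (hD : zD K P = 0) (hd : zf K ∣ P) : P = 0 := by
  rcases r with _ | r
  · exact zf_dvd_zero hP hd (Or.inl rfl)
  rcases s with _ | s
  · exact zf_dvd_zero hP hd (Or.inr rfl)
  obtain ⟨R, hR, rfl⟩ := zf_dvd hP hd
  rw [zker_A p r s 0 R hR (by omega) (by simpa using hD), mul_zero]

lemma zker_B (p : ℕ) [Fact p.Prime] [CharP K p] {a b k : ℕ} (hk : 1 ≤ k) (hp : a + b + k + 2 = p)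
    {P : MvPolynomial ZI K} (hP : P ∈ QQ K (a + k) (b + k)) (hD : zD K P = 0) (hd : zf K ∣ P) :
    ∃ g ∈ QQ K a b, zD K g = 0 ∧ P = zf K ^ k * g := by
  have key : ∀ j, j + 1 ≤ k → ∃ g ∈ QQ K (a + (k - (j + 1))) (b + (k - (j + 1))),
      P = zf K ^ (j + 1) * g := by
    intro j
    induction j with
    | zero =>
      intro hj
      obtain ⟨k, rfl⟩ : ∃ k', k = k' + 1 := ⟨k - 1, by omega⟩
      obtain ⟨R, hR, rfl⟩ := zf_dvd (r := a + k) (s := b + k) hP hd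
      exact ⟨R, by simpa using hR, by simp⟩
    | succ j ih =>
      intro hj
      obtain ⟨g, hg, rfl⟩ := ih (by omega)
      have hdg : zf K ∣ g := by
        refine zker_step hg j hD ?_
        rw [Ne, CharP.cast_eq_zero_iff K p, (Fact.out : p.Prime).dvd_mul, not_or]
        refine ⟨Nat.not_dvd_of_pos_of_lt (by omega) (by omega), ?_⟩
        rw [show a + (k - (j + 1)) + (b + (k - (j + 1))) + j + 3 = p + (k - (j + 1)) by omega,
          Nat.dvd_add_right (dvd_refl p)]
        exact Nat.not_dvd_of_pos_of_lt (by omega) (by omega)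
      rw [show k - (j + 1) = k - (j + 1 + 1) + 1 by omega] at hg
      obtain ⟨R, hR, rfl⟩ := zf_dvd hg hdg
      exact ⟨R, hR, by ring⟩
  obtain ⟨k, rfl⟩ : ∃ k', k = k' + 1 := ⟨k - 1, by omega⟩
  obtain ⟨g, hg, rfl⟩ := key k le_rfl
  simp only [Nat.sub_self, add_zero] at hg
  refine ⟨g, hg, ?_, rfl⟩
  rw [zD_fj hg, show a + b + k + 3 = p by omega, Nat.cast_mul, CharP.cast_eq_zero K p, mul_zero, zero_smul,
    add_zero] at hD
  exact (mul_eq_zero.mp hD).resolve_left (pow_ne_zero _ zf_ne)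

lemma zDp_mem {a b : ℕ} (j : ℕ) {g : MvPolynomial ZI K} (hg : g ∈ QQ K (a + j) (b + j)) :
    (zD K ^ j) g ∈ QQ K a b := by
  induction j generalizing g with
  | zero => simpa using hg
  | succ j ih =>
    rw [pow_succ, Module.End.mul_apply]
    exact ih (zD_mem hg)

lemma zDp_f (j : ℕ) : ∀ (a b : ℕ) {g : MvPolynomial ZI K}, g ∈ QQ K (a + j) (b + j) →
    (zD K ^ (j + 1)) (zf K * g) = zf K * (zD K ^ (j + 1)) g +
      (((j + 1) * (a + b + j + 3) : ℕ) : K) • (zD K ^ j) g := by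
  induction j with
  | zero => intro a b g hg; simpa using zD_f hg
  | succ j ih =>
    intro a b g hg
    have hg' : g ∈ QQ K (a + 1 + j) (b + 1 + j) := by
      rwa [show a + 1 + j = a + (j + 1) by ring, show b + 1 + j = b + (j + 1) by ring]
    rw [pow_succ' (zD K) (j + 1), Module.End.mul_apply, ih _ _ hg', map_add, zD_f (zDp_mem (j + 1) hg), map_smul,
      Module.End.mul_apply, pow_succ' (zD K) j, Module.End.mul_apply, add_assoc, ← add_smul]
    congr 2
    push_cast; ring

lemma zDp_PP (j : ℕ) (a b : ℕ) : ∃ c : ℕ, (∀ (η ξ : Fin 3 → K), (zD K ^ j) (PP η ξ (a + j) (b + j)) =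
    ((c : K) * (∑ i, η i * ξ i) ^ j) • PP η ξ a b) ∧
    ∀ p : ℕ, p.Prime → a + j < p → b + j < p → ¬ p ∣ c := by
  induction j with
  | zero => exact ⟨1, by simp, fun p hp _ _ => by simpa using hp.one_lt.ne'⟩
  | succ j ih =>
    obtain ⟨c, hc, hcp⟩ := ih
    refine ⟨c * ((a + j + 1) * (b + j + 1)), ?_, ?_⟩
    · intro η ξ
      rw [pow_succ, Module.End.mul_apply, ← add_assoc, ← add_assoc, zD_PP, map_smul, hc, smul_smul]
      congr 1
      push_cast; ring
    · intro p hp h1 h2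
      rw [hp.dvd_mul, hp.dvd_mul, not_or, not_or]
      exact ⟨hcp p hp (by omega) (by omega), Nat.not_dvd_of_pos_of_lt (by omega) (by omega),
        Nat.not_dvd_of_pos_of_lt (by omega) (by omega)⟩
end PolyE

section GenM
variable {K V V' : Type*} [Field K] [AddCommGroup V] [Module K V] [AddCommGroup V'] [Module K V']

lemma zrn (A : V →ₗ[K] V') (Q : Submodule K V) [Module.Finite K Q] :
    Module.finrank K (Q.map A) + Module.finrank K (Q ⊓ LinearMap.ker A : Submodule K V) = Module.finrank K Q := by
  have h := LinearMap.finrank_range_add_finrank_ker (A.domRestrict Q)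
  rw [LinearMap.range_domRestrict, LinearMap.ker_domRestrict] at h
  rw [← h]
  congr 1
  rw [← Submodule.map_comap_subtype, Submodule.finrank_map_subtype_eq]

lemma zrn_inj (A : V →ₗ[K] V') (Q : Submodule K V) [Module.Finite K Q] (h : ∀ v ∈ Q, A v = 0 → v = 0) :
    Module.finrank K (Q.map A) = Module.finrank K Q := by
  have h1 := zrn A Q
  have : Q ⊓ LinearMap.ker A = ⊥ := by
    rw [eq_bot_iff]; rintro v ⟨hv, hv'⟩; exact h v hv hv'
  rw [this, finrank_bot] at h1
  exact h1
end GenM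

section EvC

lemma zEv_zero {r s : ℕ} (hr : r < p) (hs : s < p) (t : ℕ) {P : MvPolynomial ZI (kbar p)}
    (hP : P ∈ QQ (kbar p) r s) : zEv p t P = 0 ↔ zf (kbar p) ∣ P :=
  ⟨fun h => zEv_dvd p hr hs hP (fun u v w => congrFun h _), zEv_zf p t P⟩

instance zM_fin (r s t : ℕ) : Module.Finite (kbar p) (zM p r s t) := by unfold zM; infer_instance

lemma zfin_of_le {K V : Type*} [Field K] [AddCommGroup V] [Module K V] {A B : Submodule K V}
    [Module.Finite K B] (h : A ≤ B) : Module.Finite K A :=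
  Submodule.finiteDimensional_of_le h

instance zW_fin (r s : ℕ) : Module.Finite (kbar p) (zW p r s) := zfin_of_le (zW_le p r s)
instance zS_fin (r s t : ℕ) : Module.Finite (kbar p) (zS p r s t) := zfin_of_le (zS_le p r s t)

lemma zM_t {r s : ℕ} (hr : r < p) (hs : s < p) (t : ℕ) :
    Module.finrank (kbar p) (zM p r s t) = Module.finrank (kbar p) (zM p r s 0) := by
  have h1 := zrn (zEv p t) (QQ (kbar p) r s)
  have h2 := zrn (zEv p 0) (QQ (kbar p) r s)
  have : QQ (kbar p) r s ⊓ LinearMap.ker (zEv p t) = QQ (kbar p) r s ⊓ LinearMap.ker (zEv p 0) := by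
    ext P
    simp only [Submodule.mem_inf, LinearMap.mem_ker]
    constructor <;> rintro ⟨h, h'⟩ <;> refine ⟨h, ?_⟩ <;> rw [zEv_zero p hr hs _ h] at * <;> assumption
  rw [this] at h1
  unfold zM
  omega

lemma zM_dim {r s : ℕ} (hr : r < p) (hs : s < p) (t : ℕ) :
    (r + 2).choose 2 * (s + 2).choose 2 ≤
      Module.finrank (kbar p) (zM p r s t) + (r + 1).choose 2 * (s + 1).choose 2 := by
  have h1 := zrn (zEv p t) (QQ (kbar p) r s)
  rw [QQ_finrank] at h1
  have h2 : Module.finrank (kbar p) (QQ (kbar p) r s ⊓ LinearMap.ker (zEv p t) : Submodule _ _) ≤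
      (r + 1).choose 2 * (s + 1).choose 2 := by
    by_cases h0 : r = 0 ∨ s = 0
    · have : QQ (kbar p) r s ⊓ LinearMap.ker (zEv p t) = ⊥ := by
        rw [eq_bot_iff]; rintro P ⟨hP, hP'⟩
        exact zf_dvd_zero hP ((zEv_zero p hr hs t hP).mp hP') h0
      rw [this, finrank_bot]; omega
    · push Not at h0
      obtain ⟨r, rfl⟩ : ∃ r', r = r' + 1 := ⟨r - 1, by omega⟩
      obtain ⟨s, rfl⟩ : ∃ r', s = r' + 1 := ⟨s - 1, by omega⟩
      have hle : QQ (kbar p) (r + 1) (s + 1) ⊓ LinearMap.ker (zEv p t) ≤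
          (QQ (kbar p) r s).map (LinearMap.mulLeft (kbar p) (zf (kbar p))) := by
        rintro P ⟨hP, hP'⟩
        obtain ⟨R, hR, rfl⟩ := zf_dvd hP ((zEv_zero p hr hs t hP).mp hP')
        exact ⟨R, hR, rfl⟩
      refine (Submodule.finrank_mono hle).trans ((Submodule.finrank_map_le _ _).trans ?_)
      rw [QQ_finrank]
  unfold zM
  omega

open MvPolynomial in
lemma zW_dim {r s : ℕ} (hr : r < p) (hs : s < p) :
    Module.finrank (kbar p) (zW p r s) = Module.finrank (kbar p) (zM p r s 0) := by
  classical
  haveI : Fintype (Gp p) := Fintype.ofFinite _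
  let A : Matrix ((Fin 3 → ZMod p) × (Fin 3 → ZMod p)) (Gp p) (kbar p) := fun z h =>
    eval (Sum.elim (fun i => zal p (z.1 i)) (fun i => zal p (z.2 i))) (PZ p (zx p h) (zy p h) r s)
  let res : MvPolynomial ZI (kbar p) →ₗ[kbar p] ((Fin 3 → ZMod p) × (Fin 3 → ZMod p) → kbar p) :=
    { toFun := fun P z => eval (Sum.elim (fun i => zal p (z.1 i)) (fun i => zal p (z.2 i))) P
      map_add' := by intro P Q; ext z; simp
      map_smul' := by intro c P; ext z; simp [smul_eval] }
  have h1 : Module.finrank (kbar p) (zW p r s) = A.rank := by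
    rw [← zrn_inj res (zW p r s), A.rank_eq_finrank_span_cols, zW, Submodule.map_span, ← Set.range_comp]
    · rfl
    · intro P hP h
      exact QQ_eq_zero p hr hs (zW_le p r s hP) (fun η ξ => congrFun h (η, ξ))
  have h2 : Module.finrank (kbar p) (zM p r s 0) = A.rank := by
    rw [A.rank_eq_finrank_span_row, zM, QQ_spanZ p hr hs, Submodule.map_span, ← Set.range_comp]
    have : (⇑(zEv p 0) ∘ fun z : (Fin 3 → ZMod p) × (Fin 3 → ZMod p) => PZ p z.1 z.2 r s) = A.row := by
      funext z h
      show zEv p 0 (PZ p z.1 z.2 r s) h = A z h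
      rw [zEv_apply, pow_zero, one_mul]
      exact PP_symm _ _ _ _ _ _
    rw [this]
  rw [h1, h2]

lemma zW_D {r s : ℕ} {P : MvPolynomial ZI (kbar p)} (hP : P ∈ zW p r s) : zD (kbar p) P = 0 := by
  by_cases h0 : r = 0 ∨ s = 0
  · exact zD_zero (zW_le p r s hP) h0
  push Not at h0
  obtain ⟨r, rfl⟩ : ∃ r', r = r' + 1 := ⟨r - 1, by omega⟩
  obtain ⟨s, rfl⟩ : ∃ r', s = r' + 1 := ⟨s - 1, by omega⟩
  have : zW p (r + 1) (s + 1) ≤ LinearMap.ker (zD (kbar p)) := by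
    rw [zW, Submodule.span_le]
    rintro _ ⟨h, rfl⟩
    show zD (kbar p) _ = 0
    simp only [PZ]
    rw [zD_PP]
    have e := congrArg (zal p) (zxy p h)
    simp only [zal, map_sum, map_mul, map_zero] at e
    rw [e]; simp
  exact this hP

lemma zSA {r s : ℕ} (hrs : r + s + 2 ≤ p) (t : ℕ) : zS p r s t = zM p r s t := by
  have hr : r < p := by omega
  have hs : s < p := by omega
  haveI : CharP (kbar p) p := kbar_charP p
  apply Submodule.eq_of_le_of_finrank_eq (zS_le p r s t)
  rw [zM_t p hr hs, ← zW_dim p hr hs, zS, zrn_inj]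
  intro P hP h
  exact zker_A' p hrs (zW_le p _ _ hP) (zW_D p hP) ((zEv_zero p hr hs t (zW_le p _ _ hP)).mp h)

lemma zSU {a b k : ℕ} (hk : 1 ≤ k) (hp : a + b + k + 2 = p) (t t' : ℕ) :
    Module.finrank (kbar p) (zM p (a + k) (b + k) t) ≤
      Module.finrank (kbar p) (zS p (a + k) (b + k) t) + Module.finrank (kbar p) (zS p a b t') := by
  have hr : a + k < p := by omega
  have hs : b + k < p := by omega
  haveI : CharP (kbar p) p := kbar_charP p
  have h1 := zrn (zEv p t) (zW p (a + k) (b + k))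
  rw [zW_dim p hr hs, ← zM_t p hr hs t] at h1
  haveI : Module.Finite (kbar p) (QQ (kbar p) a b ⊓ LinearMap.ker (zD (kbar p)) : Submodule _ _) :=
    zfin_of_le (B := QQ (kbar p) a b) inf_le_left
  have h2 : zW p (a + k) (b + k) ⊓ LinearMap.ker (zEv p t) ≤
      (QQ (kbar p) a b ⊓ LinearMap.ker (zD (kbar p))).map
        (LinearMap.mulLeft (kbar p) (zf (kbar p) ^ k)) := by
    rintro P ⟨hP, hP'⟩
    have hQ := zW_le p _ _ hP
    obtain ⟨g, hg, hgD, rfl⟩ := zker_B p hk hp hQ (zW_D p hP) ((zEv_zero p hr hs t hQ).mp hP')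
    exact ⟨g, ⟨hg, hgD⟩, rfl⟩
  have h3 := (Submodule.finrank_mono h2).trans (Submodule.finrank_map_le _ _)
  have h4 : Module.finrank (kbar p) (QQ (kbar p) a b ⊓ LinearMap.ker (zD (kbar p)) : Submodule _ _) ≤
      Module.finrank (kbar p) (zS p a b t') := by
    rw [← zrn_inj (zEv p t') (QQ (kbar p) a b ⊓ LinearMap.ker (zD (kbar p)))]
    · rw [zSA p (by omega)]
      exact Submodule.finrank_mono (Submodule.map_mono inf_le_left)
    · rintro P ⟨hP, hP'⟩ h
      exact zker_A' p (by omega) hP hP' ((zEv_zero p (by omega) (by omega) t' hP).mp h)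
  have h5 : Module.finrank (kbar p) (zS p (a + k) (b + k) t) =
    Module.finrank (kbar p) ((zW p (a + k) (b + k)).map (zEv p t)) := rfl
  omega

lemma zoccS {r s : ℕ} (hr : r < p) (hs : s < p) (t : ℕ) :
    ZOcc (rT p) (zS p r s t) (IndS p t (t + s) (t + s + r)) := by
  refine ⟨zS p r s t, ?_, zS_stab p r s t, LinearMap.id, fun g y _ => rfl, Submodule.map_id _⟩
  refine (zS_le p r s t).trans ?_
  rintro _ ⟨P, hP, rfl⟩
  exact zEv_ind p hr hs t hP

lemma zoccB {a b k : ℕ} (hk : 1 ≤ k) (hp : a + b + k + 2 = p) (t : ℕ) :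
    ZOcc (rT p) (zS p a b (t + k)) (IndS p t (t + (b + k)) (t + (b + k) + (a + k))) := by
  have hr : a + k < p := by omega
  have hs : b + k < p := by omega
  haveI : CharP (kbar p) p := kbar_charP p
  obtain ⟨c, hc, hcp⟩ := zDp_PP (K := kbar p) k a b
  have hfac : ∀ x : QQ (kbar p) (a + k) (b + k), ((zEv p t) ∘ₗ (QQ (kbar p) (a + k) (b + k)).subtype) x = 0 →
      ((zEv p (t + k)) ∘ₗ (zD (kbar p) ^ k : Module.End (kbar p) _) ∘ₗ
        (QQ (kbar p) (a + k) (b + k)).subtype) x = 0 := by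
    rintro ⟨P, hP⟩ h
    have hd := (zEv_zero p hr hs t hP).mp h
    show zEv p (t + k) ((zD (kbar p) ^ k) P) = 0
    obtain ⟨k, rfl⟩ : ∃ k', k = k' + 1 := ⟨k - 1, by omega⟩
    obtain ⟨g, hg, rfl⟩ := zf_dvd (r := a + k) (s := b + k) hP hd
    rw [zDp_f k a b hg, show a + b + k + 3 = p by omega, Nat.cast_mul, CharP.cast_eq_zero (kbar p) p, mul_zero,
      zero_smul, add_zero]
    exact zEv_zf p _ _ ⟨_, rfl⟩
  obtain ⟨C, hC⟩ := z_factor _ _ hfac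
  have hC' : ∀ P ∈ QQ (kbar p) (a + k) (b + k), C (zEv p t P) = zEv p (t + k) ((zD (kbar p) ^ k) P) :=
    fun P hP => hC ⟨P, hP⟩
  have hCZ : ∀ η ξ, C (zEv p t (PZ p η ξ (a + k) (b + k))) =
      ((c : kbar p) * zal p (η ⬝ᵥ ξ) ^ k) • zEv p (t + k) (PZ p η ξ a b) := by
    intro η ξ
    rw [hC' _ (PZ_mem p _ _ _ _), PZ, hc, map_smul, PZ]
    congr 3
    simp [dotProduct, zal]
  have hst := zM_stab p hr hs t
  have heq : ZEqv (rT p) (zM p (a + k) (b + k) t) C := by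
    rintro g _ ⟨P, hP, rfl⟩
    have hP' : P ∈ QQ (kbar p) (a + k) (b + k) := hP
    rw [QQ_spanZ p hr hs] at hP'
    clear hP
    induction hP' using Submodule.span_induction with
    | mem P h =>
      obtain ⟨z, rfl⟩ := h
      simp only
      rw [zEv_rT, map_smul, hCZ, hCZ, map_smul, zEv_rT, zcof_dot, smul_smul, smul_smul]
      congr 1
      simp only [zal, map_mul, map_pow]; ring
    | zero => simp
    | add P Q h1 h2 i1 i2 => simp only [map_add, i1, i2]
    | smul c P h1 i1 => simp only [map_smul, i1]
  refine ⟨zM p (a + k) (b + k) t, ?_, hst, C, heq, ?_⟩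
  · rintro _ ⟨P, hP, rfl⟩
    exact zEv_ind p hr hs t hP
  · refine ((zS_simp p (by omega) (by omega) (t + k)).2.2 _ (z_map_stab _ hst heq) ?_).resolve_left ?_
    · rw [zSA p (by omega)]
      rintro _ ⟨_, ⟨P, hP, rfl⟩, rfl⟩
      rw [hC' P hP]
      exact ⟨_, zDp_mem k hP, rfl⟩
    · intro hb
      have hm : C (zEv p t (PZ p ![1,0,0] ![1,0,0] (a + k) (b + k))) ∈ (zM p (a + k) (b + k) t).map C :=
        ⟨_, ⟨_, PZ_mem p _ _ _ _, rfl⟩, rfl⟩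
      rw [hb, Submodule.mem_bot, hCZ] at hm
      have h1 := congrFun hm (zbc p 0 1 0)
      rw [Pi.smul_apply, zEv_PZ, zbc_x, zbc_y, zbc_det] at h1
      have hcc : (c : kbar p) ≠ 0 := by
        rw [Ne, CharP.cast_eq_zero_iff (kbar p) p]
        exact hcp p Fact.out hr hs
      simp [dotProduct, Fin.sum_univ_three, hcc] at h1
end EvC

section Fin1

lemma zM_dim2 {r s : ℕ} (hr : r < p) (hs : s < p) (t : ℕ) :
    (r + 1) * (s + 1) * (r + s + 2) ≤ 2 * Module.finrank (kbar p) (zM p r s t) := by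
  have h := zM_dim p hr hs t
  have c2 : ∀ n : ℕ, 2 * (n + 1).choose 2 = (n + 1) * n := by
    intro n
    rw [Nat.choose_two_right, Nat.add_sub_cancel, Nat.mul_div_cancel' ]
    rw [mul_comm]; exact (Nat.even_mul_succ_self n).two_dvd
  have a1 := c2 r
  have a2 := c2 s
  have a3 := c2 (r + 1)
  have a4 := c2 (s + 1)
  have e1 : 4 * ((r + 2).choose 2 * (s + 2).choose 2) = (r + 2) * (r + 1) * ((s + 2) * (s + 1)) := by
    rw [← a3, ← a4]; ring
  have e2 : 4 * ((r + 1).choose 2 * (s + 1).choose 2) = (r + 1) * r * ((s + 1) * s) := by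
    rw [← a1, ← a2]; ring
  nlinarith

lemma zall {F : Submodule (kbar p) (Gp p → kbar p)} (hF : ZSimp (rT p) F) {x y z : ℕ}
    (hxy : ¬ x ≡ y [MOD p - 1]) (hyz : ¬ y ≡ z [MOD p - 1]) (hxz : ¬ x ≡ z [MOD p - 1])
    (h : ZOcc (rT p) F (IndS p x y z)) :
    ZOcc (rT p) F (IndS p y x z) ∧ ZOcc (rT p) F (IndS p x z y) ∧ ZOcc (rT p) F (IndS p y z x) ∧
    ZOcc (rT p) F (IndS p z x y) ∧ ZOcc (rT p) F (IndS p z y x) := by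
  have hyx : ¬ y ≡ x [MOD p - 1] := fun h => hxy h.symm
  have hzy : ¬ z ≡ y [MOD p - 1] := fun h => hyz h.symm
  have hzx : ¬ z ≡ x [MOD p - 1] := fun h => hxz h.symm
  have h1 := zocc1 p F hF y x z hyx h
  have h2 := zocc2 p F hF x z y hzy h
  have h3 := zocc2 p F hF y z x hzx h1
  have h4 := zocc1 p F hF z x y hzx h2
  have h5 := zocc1 p F hF z y x hzy h3
  exact ⟨h1, h2, h3, h4, h5⟩

lemma zmodj {N x y : ℕ} (j : ℕ) (h : x = y + j * N) : x ≡ y [MOD N] := by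
  subst h; simp [Nat.ModEq]

lemma zfin9 {P : Fin 9 → Prop} (h0 : P 0) (h1 : P 1) (h2 : P 2) (h3 : P 3) (h4 : P 4) (h5 : P 5)
    (h6 : P 6) (h7 : P 7) (h8 : P 8) : ∀ l, P l := by
  intro l; fin_cases l <;> assumption

lemma zsum9 (f : Fin 9 → ℕ) : ∑ l, f l = f 0 + f 1 + f 2 + f 3 + f 4 + f 5 + f 6 + f 7 + f 8 := by
  simp only [Fin.sum_univ_succ]
  simp only [Finset.univ_eq_empty, Finset.sum_empty, add_zero, ← add_assoc]
  rfl

structure Zv9 (f : Fin 9 → ℕ) (x0 x1 x2 x3 x4 x5 x6 x7 x8 : ℕ) : Prop where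
  e0 : f 0 = x0
  e1 : f 1 = x1
  e2 : f 2 = x2
  e3 : f 3 = x3
  e4 : f 4 = x4
  e5 : f 5 = x5
  e6 : f 6 = x6
  e7 : f 7 = x7
  e8 : f 8 = x8

lemma zvec9 (x0 x1 x2 x3 x4 x5 x6 x7 x8 : ℕ) :
    ∃ f : Fin 9 → ℕ, Zv9 f x0 x1 x2 x3 x4 x5 x6 x7 x8 :=
  ⟨![x0, x1, x2, x3, x4, x5, x6, x7, x8], rfl, rfl, rfl, rfl, rfl, rfl, rfl, rfl, rfl⟩

lemma zfamily {m n q c : ℕ} (hp : m + n + q + 4 = p) (hc : c + n + m + 2 < p - 1) :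
    ∃ F : Fin 9 → Submodule (kbar p) (Gp p → kbar p),
      (∀ l, ZSimp (rT p) (F l)) ∧ (∀ l l', l ≠ l' → ¬ ZIso (rT p) (F l) (F l')) ∧
      (∀ l, ZOcc (rT p) (F l) (IndS p c (c + n + 1) (c + n + m + 2))) ∧
      (p + 1) * (p ^ 2 + p + 1) ≤ ∑ l, Module.finrank (kbar p) (F l) := by
  set b := c + n + 1 with hb
  set a := c + n + m + 2 with ha
  set N := p - 1 with hN
  have hNe : N = m + n + q + 3 := by omega
  obtain ⟨e, he, heN, hee⟩ : ∃ e, a + 1 ≡ e [MOD N] ∧ e < N ∧ (e = a + 1 ∨ (a + 1 = N ∧ e = 0)) := by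
    by_cases h : a + 1 < N
    · exact ⟨a + 1, rfl, h, Or.inl rfl⟩
    · exact ⟨0, zmodj 1 (by omega), by omega, Or.inr ⟨by omega, rfl⟩⟩
  obtain ⟨rr, R9⟩ := zvec9 (m + 1) (q + 1) (n + 1) (m + (q + 2)) (n + (m + 2)) (q + (n + 2)) (m) (n) (q)
  obtain ⟨ss, S9⟩ := zvec9 (n + 1) (m + 1) (q + 1) (n + (q + 2)) (q + (m + 2)) (m + (n + 2)) (n) (q) (m)
  obtain ⟨tt, T9⟩ := zvec9 (c) (b) (a) (a) (b) (c) (a + (q + 2)) (b + (m + 2)) (c + (n + 2))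
  obtain ⟨w2, U9⟩ := zvec9 (b) (a) (c) (b) (c) (a) (b) (c) (a)
  obtain ⟨w3, V9⟩ := zvec9 (c) (b) (a) (a) (b) (c) (c + 1) (e) (b + 1)
  have hrr : ∀ l, rr l < p := by apply zfin9 <;> simp only [R9.e0, R9.e1, R9.e2, R9.e3, R9.e4, R9.e5, R9.e6, R9.e7, R9.e8] <;> omega
  have hss : ∀ l, ss l < p := by apply zfin9 <;> simp only [S9.e0, S9.e1, S9.e2, S9.e3, S9.e4, S9.e5, S9.e6, S9.e7, S9.e8] <;> omega
  have hw2 : ∀ l, tt l + ss l ≡ w2 l [MOD N] := by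
    apply zfin9
    · exact zmodj 0 (by rw [T9.e0, S9.e0, U9.e0]; omega)
    · exact zmodj 0 (by rw [T9.e1, S9.e1, U9.e1]; omega)
    · exact zmodj 1 (by rw [T9.e2, S9.e2, U9.e2]; omega)
    · exact zmodj 1 (by rw [T9.e3, S9.e3, U9.e3]; omega)
    · exact zmodj 1 (by rw [T9.e4, S9.e4, U9.e4]; omega)
    · exact zmodj 0 (by rw [T9.e5, S9.e5, U9.e5]; omega)
    · exact zmodj 1 (by rw [T9.e6, S9.e6, U9.e6]; omega)
    · exact zmodj 1 (by rw [T9.e7, S9.e7, U9.e7]; omega)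
    · exact zmodj 0 (by rw [T9.e8, S9.e8, U9.e8]; omega)
  have hw3 : ∀ l, tt l ≡ w3 l [MOD N] := by
    apply zfin9
    · exact zmodj 0 (by rw [T9.e0, V9.e0]; omega)
    · exact zmodj 0 (by rw [T9.e1, V9.e1]; omega)
    · exact zmodj 0 (by rw [T9.e2, V9.e2]; omega)
    · exact zmodj 0 (by rw [T9.e3, V9.e3]; omega)
    · exact zmodj 0 (by rw [T9.e4, V9.e4]; omega)
    · exact zmodj 0 (by rw [T9.e5, V9.e5]; omega)
    · exact zmodj 1 (by rw [T9.e6, V9.e6]; omega)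
    · rw [T9.e7, V9.e7, show b + (m + 2) = a + 1 by omega]; exact he
    · exact zmodj 0 (by rw [T9.e8, V9.e8]; omega)
  have hl2 : ∀ l, w2 l < N := by apply zfin9 <;> simp only [U9.e0, U9.e1, U9.e2, U9.e3, U9.e4, U9.e5, U9.e6, U9.e7, U9.e8] <;> omega
  have hl3 : ∀ l, w3 l < N := by apply zfin9 <;> simp only [V9.e0, V9.e1, V9.e2, V9.e3, V9.e4, V9.e5, V9.e6, V9.e7, V9.e8] <;> omega
  have hinj : ∀ l l', w2 l = w2 l' → w3 l = w3 l' → l = l' := by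
    intro l l'
    revert l l'; apply zfin9 <;> apply zfin9 <;> intro h1 h2 <;> first | rfl | (exfalso; simp only [U9.e0, U9.e1, U9.e2, U9.e3, U9.e4, U9.e5, U9.e6, U9.e7, U9.e8, V9.e0, V9.e1, V9.e2, V9.e3, V9.e4, V9.e5, V9.e6, V9.e7, V9.e8] at h1 h2; omega)
  have hab : ¬ c ≡ b [MOD N] := fun h => by
    have := Nat.ModEq.eq_of_lt_of_lt h (by omega) (by omega); omega
  have hbc : ¬ b ≡ a [MOD N] := fun h => by
    have := Nat.ModEq.eq_of_lt_of_lt h (by omega) (by omega); omega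
  have hac : ¬ c ≡ a [MOD N] := fun h => by
    have := Nat.ModEq.eq_of_lt_of_lt h (by omega) (by omega); omega
  have hba : ¬ b ≡ c [MOD N] := fun h => hab h.symm
  have hcb : ¬ a ≡ b [MOD N] := fun h => hbc h.symm
  have hca : ¬ a ≡ c [MOD N] := fun h => hac h.symm
  have hS : ∀ l, ZSimp (rT p) (zS p (rr l) (ss l) (tt l)) := fun l => zS_simp p (hrr l) (hss l) _
  refine ⟨fun l => zS p (rr l) (ss l) (tt l), hS, ?_, ?_, ?_⟩
  · intro l l' hne hiso
    obtain ⟨-, h2, h3⟩ := zS_iso p (hrr l') (hss l') hiso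
    apply hne
    apply hinj
    · exact Nat.ModEq.eq_of_lt_of_lt (((hw2 l).symm.trans h2).trans (hw2 l')) (hl2 l) (hl2 l')
    · exact Nat.ModEq.eq_of_lt_of_lt (((hw3 l).symm.trans h3).trans (hw3 l')) (hl3 l) (hl3 l')
  · have hocc1 : ∀ l, ZOcc (rT p) (zS p (rr l) (ss l) (tt l))
        (IndS p (tt l) (tt l + ss l) (tt l + ss l + rr l)) := fun l => zoccS p (hrr l) (hss l) _
    apply zfin9
    · have h := hocc1 0
      have hk := hS 0
      beta_reduce
      rw [R9.e0, S9.e0, T9.e0] at h hk ⊢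
      rw [IndS_congr p (a' := c) (b' := b) (c' := a) (zmodj 0 (by omega))
        (zmodj 0 (by omega)) (zmodj 0 (by omega))] at h
      exact h
    · have h := hocc1 1
      have hk := hS 1
      beta_reduce
      rw [R9.e1, S9.e1, T9.e1] at h hk ⊢
      rw [IndS_congr p (a' := b) (b' := a) (c' := c) (zmodj 0 (by omega))
        (zmodj 0 (by omega)) (zmodj 1 (by omega))] at h
      exact (zall p hk hbc hca hba h).2.2.2.1
    · have h := hocc1 2
      have hk := hS 2
      beta_reduce
      rw [R9.e2, S9.e2, T9.e2] at h hk ⊢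
      rw [IndS_congr p (a' := a) (b' := c) (c' := b) (zmodj 0 (by omega))
        (zmodj 1 (by omega)) (zmodj 1 (by omega))] at h
      exact (zall p hk hca hab hcb h).2.2.1
    · have h := hocc1 3
      have hk := hS 3
      beta_reduce
      rw [R9.e3, S9.e3, T9.e3] at h hk ⊢
      rw [IndS_congr p (a' := a) (b' := b) (c' := c) (zmodj 0 (by omega))
        (zmodj 1 (by omega)) (zmodj 2 (by omega))] at h
      exact (zall p hk hcb hba hca h).2.2.2.2
    · have h := hocc1 4
      have hk := hS 4
      beta_reduce
      rw [R9.e4, S9.e4, T9.e4] at h hk ⊢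
      rw [IndS_congr p (a' := b) (b' := c) (c' := a) (zmodj 0 (by omega))
        (zmodj 1 (by omega)) (zmodj 1 (by omega))] at h
      exact (zall p hk hba hac hbc h).1
    · have h := hocc1 5
      have hk := hS 5
      beta_reduce
      rw [R9.e5, S9.e5, T9.e5] at h hk ⊢
      rw [IndS_congr p (a' := c) (b' := a) (c' := b) (zmodj 0 (by omega))
        (zmodj 0 (by omega)) (zmodj 1 (by omega))] at h
      exact (zall p hk hac hcb hab h).2.1
    · have h := zoccB p (a := m) (b := n) (k := q + 2) (by omega) (by omega) a
      rw [IndS_congr p (a' := a) (b' := b) (c' := c) (zmodj 0 (by omega))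
        (zmodj 1 (by omega)) (zmodj 2 (by omega))] at h
      have hk := hS 6
      beta_reduce
      rw [R9.e6, S9.e6, T9.e6] at hk ⊢
      exact (zall p hk hcb hba hca h).2.2.2.2
    · have h := zoccB p (a := n) (b := q) (k := m + 2) (by omega) (by omega) b
      rw [IndS_congr p (a' := b) (b' := c) (c' := a) (zmodj 0 (by omega))
        (zmodj 1 (by omega)) (zmodj 1 (by omega))] at h
      have hk := hS 7
      beta_reduce
      rw [R9.e7, S9.e7, T9.e7] at hk ⊢
      exact (zall p hk hba hac hbc h).1
    · have h := zoccB p (a := q) (b := m) (k := n + 2) (by omega) (by omega) c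
      rw [IndS_congr p (a' := c) (b' := a) (c' := b) (zmodj 0 (by omega))
        (zmodj 0 (by omega)) (zmodj 1 (by omega))] at h
      have hk := hS 8
      beta_reduce
      rw [R9.e8, S9.e8, T9.e8] at hk ⊢
      exact (zall p hk hac hcb hab h).2.1
  · have A1 := zM_dim2 p (hrr 0) (hss 0) (tt 0)
    have A2 := zM_dim2 p (hrr 1) (hss 1) (tt 1)
    have A3 := zM_dim2 p (hrr 2) (hss 2) (tt 2)
    have U1 := zM_dim2 p (hrr 3) (hss 3) (tt 3)
    have U2 := zM_dim2 p (hrr 4) (hss 4) (tt 4)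
    have U3 := zM_dim2 p (hrr 5) (hss 5) (tt 5)
    have V1 := zSU p (a := m) (b := n) (k := q + 2) (by omega) (by omega) (tt 3) (tt 6)
    have V2 := zSU p (a := n) (b := q) (k := m + 2) (by omega) (by omega) (tt 4) (tt 7)
    have V3 := zSU p (a := q) (b := m) (k := n + 2) (by omega) (by omega) (tt 5) (tt 8)
    rw [← zSA p (by rw [R9.e0, S9.e0]; omega)] at A1
    rw [← zSA p (by rw [R9.e1, S9.e1]; omega)] at A2
    rw [← zSA p (by rw [R9.e2, S9.e2]; omega)] at A3
    rw [← R9.e3, ← S9.e3, ← R9.e6, ← S9.e6] at V1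
    rw [← R9.e4, ← S9.e4, ← R9.e7, ← S9.e7] at V2
    rw [← R9.e5, ← S9.e5, ← R9.e8, ← S9.e8] at V3
    have key : 2 * ((p + 1) * (p ^ 2 + p + 1)) =
        (rr 0 + 1) * (ss 0 + 1) * (rr 0 + ss 0 + 2) + (rr 1 + 1) * (ss 1 + 1) * (rr 1 + ss 1 + 2) +
        (rr 2 + 1) * (ss 2 + 1) * (rr 2 + ss 2 + 2) + (rr 3 + 1) * (ss 3 + 1) * (rr 3 + ss 3 + 2) +
        (rr 4 + 1) * (ss 4 + 1) * (rr 4 + ss 4 + 2) + (rr 5 + 1) * (ss 5 + 1) * (rr 5 + ss 5 + 2) := by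
      rw [R9.e0, R9.e1, R9.e2, R9.e3, R9.e4, R9.e5, S9.e0, S9.e1, S9.e2, S9.e3, S9.e4, S9.e5, ← hp]; ring
    rw [zsum9 (fun l => Module.finrank (kbar p) (zS p (rr l) (ss l) (tt l)))]
    beta_reduce
    omega

lemma zfamily' {a b c : ℕ} (hab : ¬ a ≡ b [MOD p - 1]) (hbc : ¬ b ≡ c [MOD p - 1])
    (hac : ¬ a ≡ c [MOD p - 1]) :
    ∃ F : Fin 9 → Submodule (kbar p) (Gp p → kbar p),
      (∀ l, ZSimp (rT p) (F l)) ∧ (∀ l l', l ≠ l' → ¬ ZIso (rT p) (F l) (F l')) ∧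
      (∀ l, ZOcc (rT p) (F l) (IndS p a b c)) ∧
      (p + 1) * (p ^ 2 + p + 1) ≤ ∑ l, Module.finrank (kbar p) (F l) := by
  have hN : 0 < p - 1 := by have := (Fact.out : p.Prime).two_le; omega
  have hsort : ∀ x y z : ℕ, x < y → y < z → z < p - 1 →
      ∃ F : Fin 9 → Submodule (kbar p) (Gp p → kbar p),
      (∀ l, ZSimp (rT p) (F l)) ∧ (∀ l l', l ≠ l' → ¬ ZIso (rT p) (F l) (F l')) ∧
      (∀ l, ZOcc (rT p) (F l) (IndS p x y z)) ∧
      (p + 1) * (p ^ 2 + p + 1) ≤ ∑ l, Module.finrank (kbar p) (F l) := by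
    intro x y z h1 h2 h3
    have := zfamily p (m := z - y - 1) (n := y - x - 1) (q := p - 1 - (z - x) - 1) (c := x)
      (by omega) (by omega)
    rwa [show x + (y - x - 1) + 1 = y by omega, show x + (y - x - 1) + (z - y - 1) + 2 = z by omega] at this
  have hgen : ∀ x y z : ℕ, x < y → y < z → z < p - 1 →
      ∃ F : Fin 9 → Submodule (kbar p) (Gp p → kbar p),
      (∀ l, ZSimp (rT p) (F l)) ∧ (∀ l l', l ≠ l' → ¬ ZIso (rT p) (F l) (F l')) ∧
      (∀ l, ZOcc (rT p) (F l) (IndS p x y z) ∧ ZOcc (rT p) (F l) (IndS p y x z) ∧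
        ZOcc (rT p) (F l) (IndS p x z y) ∧ ZOcc (rT p) (F l) (IndS p y z x) ∧
        ZOcc (rT p) (F l) (IndS p z x y) ∧ ZOcc (rT p) (F l) (IndS p z y x)) ∧
      (p + 1) * (p ^ 2 + p + 1) ≤ ∑ l, Module.finrank (kbar p) (F l) := by
    intro x y z h1 h2 h3
    obtain ⟨F, f1, f2, f3, f4⟩ := hsort x y z h1 h2 h3
    refine ⟨F, f1, f2, fun l => ⟨f3 l, zall p (f1 l) ?_ ?_ ?_ (f3 l)⟩, f4⟩
    · intro h; have := Nat.ModEq.eq_of_lt_of_lt h (by omega) (by omega); omega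
    · intro h; have := Nat.ModEq.eq_of_lt_of_lt h (by omega) (by omega); omega
    · intro h; have := Nat.ModEq.eq_of_lt_of_lt h (by omega) (by omega); omega
  have hI : IndS p a b c = IndS p (a % (p - 1)) (b % (p - 1)) (c % (p - 1)) :=
    IndS_congr p (Nat.mod_modEq _ _).symm (Nat.mod_modEq _ _).symm (Nat.mod_modEq _ _).symm
  rw [hI]
  have la := Nat.mod_lt a hN
  have lb := Nat.mod_lt b hN
  have lc := Nat.mod_lt c hN
  rcases lt_or_gt_of_ne hab with h1 | h1 <;> rcases lt_or_gt_of_ne hbc with h2 | h2 <;>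
    rcases lt_or_gt_of_ne hac with h3 | h3
  · obtain ⟨F, f1, f2, f3, f4⟩ := hgen _ _ _ h1 h2 lc
    exact ⟨F, f1, f2, fun l => (f3 l).1, f4⟩
  · omega
  · obtain ⟨F, f1, f2, f3, f4⟩ := hgen _ _ _ h3 h2 lb
    exact ⟨F, f1, f2, fun l => (f3 l).2.2.1, f4⟩
  · obtain ⟨F, f1, f2, f3, f4⟩ := hgen _ _ _ h3 h1 lb
    exact ⟨F, f1, f2, fun l => (f3 l).2.2.2.1, f4⟩
  · obtain ⟨F, f1, f2, f3, f4⟩ := hgen _ _ _ h1 h3 lc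
    exact ⟨F, f1, f2, fun l => (f3 l).2.1, f4⟩
  · obtain ⟨F, f1, f2, f3, f4⟩ := hgen _ _ _ h2 h3 la
    exact ⟨F, f1, f2, fun l => (f3 l).2.2.2.2.1, f4⟩
  · omega
  · obtain ⟨F, f1, f2, f3, f4⟩ := hgen _ _ _ h2 h1 la
    exact ⟨F, f1, f2, fun l => (f3 l).2.2.2.2.2, f4⟩

lemma zfac_trans {X₁ Y₁ X₂ Y₂ F : Submodule (kbar p) (Gp p → kbar p)}
    (h : GFactorIso p X₁ Y₁ X₂ Y₂) (hf : ZFac (rT p) X₂ Y₂ F) : ZFac (rT p) X₁ Y₁ F := by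
  obtain ⟨hX₁, hY₁, hX₂, hY₂, e, he⟩ := h
  obtain ⟨ψ, hψ, hmap, hker⟩ := hf
  let lf : (Y₂ ⧸ X₂.comap Y₂.subtype) →ₗ[kbar p] (Gp p → kbar p) :=
    Submodule.liftQ _ (ψ ∘ₗ Y₂.subtype) (by
      intro y hy
      exact (hker y y.2).mpr hy)
  have lfm : ∀ y : Y₂, lf (Submodule.Quotient.mk y) = ψ y := fun y => Submodule.liftQ_apply _ _ _
  obtain ⟨C, hC⟩ := LinearMap.exists_extend (lf ∘ₗ e.toLinearMap ∘ₗ (X₁.comap Y₁.subtype).mkQ)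
  have hC' : ∀ y : Y₁, C y = lf (e (Submodule.Quotient.mk y)) := fun y => LinearMap.congr_fun hC y
  refine ⟨C, ?_, ?_, ?_⟩
  · intro g y hy
    have h1 := hC' ⟨rT p g y, hY₁ g y hy⟩
    have h2 := hC' ⟨y, hy⟩
    simp only at h1 h2
    rw [h1, h2]
    have h3 := he g (Submodule.Quotient.mk ⟨y, hy⟩)
    have h4 : subquotAct p X₁ Y₁ hX₁ hY₁ g (Submodule.Quotient.mk ⟨y, hy⟩) =
      Submodule.Quotient.mk ⟨rT p g y, hY₁ g y hy⟩ := rfl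
    rw [h4] at h3
    rw [h3]
    obtain ⟨z, hz⟩ := Submodule.Quotient.mk_surjective _ (e (Submodule.Quotient.mk ⟨y, hy⟩))
    rw [← hz]
    have h5 : subquotAct p X₂ Y₂ hX₂ hY₂ g (Submodule.Quotient.mk z) =
      Submodule.Quotient.mk ⟨rT p g z, hY₂ g z z.2⟩ := rfl
    rw [h5, lfm, lfm]
    exact hψ g z z.2
  · rw [← hmap]
    ext f
    constructor
    · rintro ⟨y, hy, rfl⟩
      rw [hC' ⟨y, hy⟩]
      obtain ⟨z, hz⟩ := Submodule.Quotient.mk_surjective _ (e (Submodule.Quotient.mk ⟨y, hy⟩))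
      rw [← hz, lfm]
      exact ⟨z, z.2, rfl⟩
    · rintro ⟨z, hz, rfl⟩
      obtain ⟨y, hy⟩ := Submodule.Quotient.mk_surjective _ (e.symm (Submodule.Quotient.mk ⟨z, hz⟩))
      refine ⟨y, y.2, ?_⟩
      rw [hC', hy, e.apply_symm_apply, lfm]
  · intro x hx
    rw [hC' ⟨x, hx⟩]
    obtain ⟨z, hz⟩ := Submodule.Quotient.mk_surjective _ (e (Submodule.Quotient.mk ⟨x, hx⟩))
    rw [← hz, lfm, hker z z.2]
    have h1 : (z : Gp p → kbar p) ∈ X₂ ↔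
      (Submodule.Quotient.mk z : Y₂ ⧸ X₂.comap Y₂.subtype) = 0 :=
      (Submodule.Quotient.mk_eq_zero (X₂.comap Y₂.subtype)).symm
    have h2 : (x : Gp p → kbar p) ∈ X₁ ↔
      (Submodule.Quotient.mk ⟨x, hx⟩ : Y₁ ⧸ X₁.comap Y₁.subtype) = 0 :=
      (Submodule.Quotient.mk_eq_zero (X₁.comap Y₁.subtype) (x := ⟨x, hx⟩)).symm
    rw [h1, h2, hz]
    exact e.map_eq_zero_iff
end Fin1

/-- For `a, b, c` pairwise distinct mod `p - 1`, the principal series `Ind_B^G (η^a⊗η^b⊗η^c)`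
over `𝔽̄_p` is multiplicity free: in any composition series (chain of `G`-stable subspaces
from `0` to `Ind_B^G χ` with simple factors), the factors are pairwise non-isomorphic. -/
theorem stmt15 (a b c : ℕ)
    (hab : ¬ a ≡ b [MOD p - 1]) (hbc : ¬ b ≡ c [MOD p - 1]) (hac : ¬ a ≡ c [MOD p - 1])
    (n : ℕ) (ch : Fin (n + 1) → Submodule (kbar p) (Gp p → kbar p))
    (h0 : ch 0 = ⊥) (hlast : (ch (Fin.last n) : Set (Gp p → kbar p)) = IndSet p a b c)
    (hsimple : ∀ i : Fin n, GSimpleFactor p (ch i.castSucc) (ch i.succ)) :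
    ∀ i j : Fin n, i ≠ j →
      ¬ GFactorIso p (ch i.castSucc) (ch i.succ) (ch j.castSucc) (ch j.succ) := by
  intro i j hij hiso
  have hl : ch (Fin.last n) = IndS p a b c := SetLike.coe_injective hlast
  obtain ⟨F, f1, f2, f3, f4⟩ := zfamily' p hab hbc hac
  obtain ⟨L, hL, hfac⟩ := z_core (rT p) F f1 f2 ch h0
    (by
      intro k
      refine Fin.cases ?_ ?_ k
      · rw [h0]; intro g f hf
        rw [Submodule.mem_bot] at hf ⊢
        rw [hf, map_zero]
      · intro k; exact (hsimple k).2.1)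
    (fun k => (hsimple k).2.2.1) (fun k => (hsimple k).2.2.2)
    (by rw [hl]; exact f3) (by rw [hl]; exact (zIndS_dim p a b c).trans f4)
  exact f2 (L i) (L j) (fun h => hij (hL h))
    (z_fac_iso (rT p) (hsimple i).2.1 (hfac i) (zfac_trans p hiso (hfac j)))
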